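/- Let k < n be positive integers, K a field, 0 ≤ ℓ ≤ n, and v ≤ w in I_{k,n}. Then the restricted ideal G_{k,n,ℓ}|_w^v = ker(φ_ℓ)|_{T_w^v} is contained in the initial ideal in_{w_ℓ}(I(X_w^v)), where I(X_w^v) = G_{k,n}|_{T_w^v} is the ideal of the Richardson variety and the initial ideal is taken with respect to the matching field weight vector w_ℓ on the variables P_I, I ∈ T_w^v. -/

import Mathlib

open MvPolynomial

/-- `IsIdx n k J` : `J` is a strictly increasing `k`-tuple with entries in `{1, …, n}`,
representing an element `{J 0 < J 1 < … < J (k-1)}` of `I_{k,n}`. -/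
def IsIdx (n k : ℕ) (J : Fin k → ℕ) : Prop :=
  StrictMono J ∧ ∀ s, 1 ≤ J s ∧ J s ≤ n

/-- Componentwise (Bruhat) order on sorted tuples. -/
def TupLe {k : ℕ} (I J : Fin k → ℕ) : Prop := ∀ s, I s ≤ J s

/-- Index type of the Plücker variables `P_I`, `I ∈ I_{k,n}`. -/
def PlVar (n k : ℕ) : Type := {J : Fin k → ℕ // IsIdx n k J}

/-- The number of entries of `J` lying in `{1, …, ℓ}`. -/
def nSmall {k : ℕ} (ℓ : ℕ) (J : Fin k → ℕ) : ℕ :=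
  (Finset.univ.filter fun s => J s ≤ ℓ).card

/-- Row assignment of the block diagonal matching field `B_ℓ` : the entry of `J` in sorted
position `i` (0-indexed) is placed in this (1-indexed) row. -/
def mfRow {k : ℕ} (ℓ : ℕ) (J : Fin k → ℕ) (i : Fin k) : ℕ :=
  if 2 ≤ k ∧ nSmall ℓ J = 1 then
    (if (i : ℕ) = 0 then 2 else if (i : ℕ) = 1 then 1 else (i : ℕ) + 1)
  else (i : ℕ) + 1

/-- The monomial map `φ_ℓ` of the block diagonal matching field `B_ℓ`. -/
noncomputable def phiMF (K : Type*) [Field K] (n k ℓ : ℕ) :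
    MvPolynomial (PlVar n k) K →ₐ[K] MvPolynomial (ℕ × ℕ) K :=
  aeval fun J => ∏ i : Fin k, X (mfRow ℓ J.val i, J.val i)

/-- The Plücker map, sending `P_J` to the `k × k` minor on columns `J`
of the generic matrix `(x_{i,j})`. -/
noncomputable def pluMap (K : Type*) [Field K] (n k : ℕ) :
    MvPolynomial (PlVar n k) K →ₐ[K] MvPolynomial (ℕ × ℕ) K :=
  aeval fun J =>
    (Matrix.of fun r c : Fin k => (X ((r : ℕ) + 1, J.val c) : MvPolynomial (ℕ × ℕ) K)).det

/-- Restriction `G|_T = (G + ⟨P_I : I ∉ T⟩) ∩ K[P_I : I ∈ T]` of an ideal to the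
variables indexed by `T`. -/
noncomputable def restrictIdeal {K : Type*} [Field K] {n k : ℕ}
    (G : Ideal (MvPolynomial (PlVar n k) K)) (T : Set (PlVar n k)) :
    Ideal (MvPolynomial T K) :=
  Ideal.comap (rename fun x : T => (x : PlVar n k))
    (G ⊔ Ideal.span (X '' {J | J ∉ T}))

/-- An ideal of a polynomial ring is monomial-free if it contains no monomial. -/
def MonomialFree {K : Type*} [Field K] {σ : Type*} (I : Ideal (MvPolynomial σ K)) : Prop :=
  ∀ m : σ →₀ ℕ, (monomial m (1 : K)) ∉ I

/-- `T_w^v = {I ∈ I_{k,n} : v ≤ I ≤ w}`. -/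
def TWV {n k : ℕ} (v w : PlVar n k) : Set (PlVar n k) :=
  {J | TupLe v.val J.val ∧ TupLe J.val w.val}

/-- `{I ∈ I_{k,n} : I ≤ w}`. -/
def TleW {n k : ℕ} (w : PlVar n k) : Set (PlVar n k) := {J | TupLe J.val w.val}

/-- `{I ∈ I_{k,n} : v ≤ I}`. -/
def TgeV {n k : ℕ} (v : PlVar n k) : Set (PlVar n k) := {J | TupLe v.val J.val}

/-- The weight matrix `M_ℓ` (rows and columns 1-indexed). -/
def Mmat (n ℓ : ℕ) (i j : ℕ) : ℤ :=
  if i = 2 then (if j ≤ ℓ then (ℓ : ℤ) - j + 1 else (n : ℤ) - j + ℓ + 1)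
  else ((i : ℤ) - 1) * ((n : ℤ) - j + 1)

/-- The weight `w_ℓ(P_J)` induced by `M_ℓ` on the Plücker variable `P_J`. -/
def wVec (n ℓ : ℕ) {k : ℕ} (J : Fin k → ℕ) : ℤ :=
  ∑ i : Fin k, Mmat n ℓ (mfRow ℓ J i) (J i)

/-- Weight of an exponent vector with respect to a weight vector `u`. -/
def expWt {σ : Type*} (u : σ → ℤ) (m : σ →₀ ℕ) : ℤ := m.sum fun i e => u i * (e : ℤ)

/-- Initial form of a polynomial: the sum of its terms of minimal `u`-weight. -/
noncomputable def initialForm {K σ : Type*} [Field K] (u : σ → ℤ) (f : MvPolynomial σ K) :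
    MvPolynomial σ K :=
  ∑ m ∈ f.support.filter (fun m => ∀ m' ∈ f.support, expWt u m ≤ expWt u m'),
    monomial m (coeff m f)

/-- Initial ideal with respect to the weight vector `u`. -/
noncomputable def initialIdeal {K σ : Type*} [Field K] (u : σ → ℤ)
    (I : Ideal (MvPolynomial σ K)) : Ideal (MvPolynomial σ K) :=
  Ideal.span {g | ∃ f ∈ I, g = initialForm u f}

/-- `w_0 I = {n + 1 - i : i ∈ I}`, as a sorted tuple. -/
def w0t (n : ℕ) {k : ℕ} (I : Fin k → ℕ) : Fin k → ℕ :=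
  fun s => n + 1 - I ⟨k - 1 - (s : ℕ), by have := s.isLt; omega⟩

/-- Membership in `Z_{k,n}` : either `J = {1, …, k-1, i}` with `k ≤ i ≤ n`,
or `J = {1, …, k+1} \\ {i}` with `1 ≤ i ≤ k-1`. -/
def ZPred (n k : ℕ) (J : Fin k → ℕ) : Prop :=
  (∃ i, k ≤ i ∧ i ≤ n ∧
    ∀ s : Fin k, J s = if (s : ℕ) + 1 < k then (s : ℕ) + 1 else i) ∨
  (∃ i, 1 ≤ i ∧ i ≤ k - 1 ∧
    ∀ s : Fin k, J s = if (s : ℕ) + 1 < i then (s : ℕ) + 1 else (s : ℕ) + 2)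

/-- A two-column semi-standard Young tableau with columns `I`, `J`. -/
def SSYT (n k : ℕ) (I J : Fin k → ℕ) : Prop :=
  IsIdx n k I ∧ IsIdx n k J ∧ ∀ s, I s ≤ J s

/-- The map `Γ_ℓ` on two-column semi-standard Young tableaux (columns as sorted tuples). -/
def Gamma (ℓ : ℕ) {k : ℕ} (I J : Fin k → ℕ) : (Fin k → ℕ) × (Fin k → ℕ) :=
  if h : 2 ≤ k then
    let i0 := I ⟨0, by omega⟩
    let i1 := I ⟨1, by omega⟩
    let j0 := J ⟨0, by omega⟩
    let j1 := J ⟨1, by omega⟩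
    if (i0 ≤ ℓ ∧ i1 ≤ ℓ ∧ j0 ≤ ℓ ∧ ℓ < j1 ∧ i0 < j0 ∧ j0 < i1) ∨
       (i0 ≤ ℓ ∧ ℓ < i1 ∧ ℓ < j0 ∧ ℓ < j1 ∧ j0 < i1 ∧ i1 < j1) then
      ((fun s => if (s : ℕ) = 0 then j0 else I s), (fun s => if (s : ℕ) = 0 then i0 else J s))
    else (I, J)
  else (I, J)

/-- A column (a `k`-subset given as a sorted tuple) displayed in `B_ℓ`-order:
when `k ≥ 2` and exactly one entry is `≤ ℓ`, the two smallest entries are swapped. -/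
def rowArrange (ℓ : ℕ) {k : ℕ} (C : Fin k → ℕ) : Fin k → ℕ :=
  if h : 2 ≤ k then
    (if nSmall ℓ C = 1 then
      fun s => if (s : ℕ) = 0 then C ⟨1, by omega⟩
        else if (s : ℕ) = 1 then C ⟨0, by omega⟩ else C s
    else C)
  else C

/-- Two two-column tableaux (with columns `A,B` resp. `C,D`) are row-wise equal. -/
def rowEq {k : ℕ} (A B C D : Fin k → ℕ) : Prop :=
  ∀ s, ({A s, B s} : Multiset ℕ) = {C s, D s}

/-- The kernel of the restricted monomial map `φ_ℓ|_T`. -/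
noncomputable def kerPhiRes (K : Type*) [Field K] (n k ℓ : ℕ) (T : Set (PlVar n k)) :
    Ideal (MvPolynomial T K) :=
  RingHom.ker ((phiMF K n k ℓ).comp (rename fun x : T => (x : PlVar n k)))

/-- The ideal `I(X_w^v)` of the Richardson variety: the restriction of the
Plücker ideal `G_{k,n}` to the variables in `T_w^v`. -/
noncomputable def richIdeal (K : Type*) [Field K] (n k : ℕ) (v w : PlVar n k) :
    Ideal (MvPolynomial (TWV v w) K) :=
  restrictIdeal (RingHom.ker (pluMap K n k)) (TWV v w)

/-- The alternating map obtained by freezing the arguments outside `A`. -/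
def frozenAlt {R M : Type*} [CommRing R] [AddCommGroup M] [Module R M] {ι : Type*} [DecidableEq ι]
    (D : M [⋀^ι]→ₗ[R] R) (A : Finset ι) (c : ι → M) : M [⋀^{i // i ∈ A}]→ₗ[R] R :=
  { D.toMultilinearMap.domDomRestrict (fun i => i ∈ A) (fun i => c i) with
    map_eq_zero_of_eq' := by
      intro x i j hx hij
      refine D.map_eq_zero_of_eq _ (i := i.1) (j := j.1) ?_ (fun h => hij (Subtype.ext h))
      simp only [i.2, j.2, dif_pos]
      exact hx }

theorem frozenAlt_apply {R M : Type*} [CommRing R] [AddCommGroup M] [Module R M] {ι : Type*}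
    [DecidableEq ι] (D : M [⋀^ι]→ₗ[R] R) (A : Finset ι) (c : ι → M) (x : {i // i ∈ A} → M) :
    frozenAlt D A c x = D (fun i => if h : i ∈ A then x ⟨i, h⟩ else c i) := rfl

/-- Garnir relation: the product of two determinants is a signed sum of products obtained by
nontrivial exchanges between the arguments in `A` and those in `B`. -/
theorem garnir {R : Type*} [CommRing R] [IsDomain R] {k : ℕ}
    (D : (Fin k → R) [⋀^Fin k]→ₗ[R] R)
    (u v : Fin k → Fin k → R) (A B : Finset (Fin k)) (hAB : k < A.card + B.card)
    (S : AddSubgroup R)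
    (hS : ∀ π : Equiv.Perm ({i // i ∈ A} ⊕ {i // i ∈ B}), (∃ a b, π (Sum.inl a) = Sum.inr b) →
      D (fun i => if h : i ∈ A then
          Sum.elim (fun a => u a.1) (fun b => v b.1) (π (Sum.inl ⟨i, h⟩)) else u i) *
      D (fun i => if h : i ∈ B then
          Sum.elim (fun a => u a.1) (fun b => v b.1) (π (Sum.inr ⟨i, h⟩)) else v i) ∈ S) :
    D u * D v ∈ S := by
  classical
  set z : {i // i ∈ A} ⊕ {i // i ∈ B} → (Fin k → R) :=
    Sum.elim (fun a => u a.1) (fun b => v b.1) with hz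
  have h0 : (frozenAlt D A u).domCoprod (frozenAlt D B v) z = 0 := by
    apply AlternatingMap.map_linearDependent
    intro hli
    have := hli.fintype_card_le_finrank
    simp at this
    omega
  have h1 := congrArg (LinearMap.mul' R R) h0
  rw [AlternatingMap.domCoprod_apply, _root_.sum_apply, map_sum, map_zero] at h1
  obtain ⟨s, hs, h1⟩ : ∃ s : Finset (Equiv.Perm.ModSumCongr {i // i ∈ A} {i // i ∈ B}),
      (∀ σ, σ ∈ s) ∧ ∑ x ∈ s, (LinearMap.mul' R R) ((AlternatingMap.domCoprod.summand
        (frozenAlt D A u) (frozenAlt D B v) x) z) = 0 := ⟨_, fun σ => Finset.mem_univ σ, h1⟩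
  rw [← Finset.add_sum_erase s _ (hs (Quotient.mk'' 1))] at h1
  have h2 : LinearMap.mul' R R (AlternatingMap.domCoprod.summand (frozenAlt D A u)
      (frozenAlt D B v) (Quotient.mk'' 1) z) = D u * D v := by
    rw [AlternatingMap.domCoprod.summand_mk'']
    simp [frozenAlt_apply, hz]
  rw [h2] at h1
  rw [eq_neg_of_add_eq_zero_left h1]
  refine S.neg_mem (S.sum_mem ?_)
  intro σ hσ
  induction σ using Quotient.inductionOn' with | _ σ
  have hne : ∃ a b, σ (Sum.inl a) = Sum.inr b := by
    by_contra hcon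
    push Not at hcon
    apply (Finset.mem_erase.1 hσ).1
    have : σ ∈ (Equiv.Perm.sumCongrHom {i // i ∈ A} {i // i ∈ B}).range := by
      apply Equiv.Perm.mem_sumCongrHom_range_of_perm_mapsTo_inl
      rintro _ ⟨a, rfl⟩
      rcases h : σ (Sum.inl a) with c | c
      · exact ⟨c, rfl⟩
      · exact absurd h (hcon a c)
    refine Quotient.sound' ?_
    rw [QuotientGroup.leftRel_apply]
    simpa using this
  have := hS σ hne
  rw [AlternatingMap.domCoprod.summand_mk'']
  rcases Int.units_eq_one_or (Equiv.Perm.sign σ) with h | h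
  · rw [h]
    simpa [frozenAlt_apply] using this
  · rw [h]
    simpa [frozenAlt_apply] using this


/-- The minor on an arbitrary tuple of columns. -/
noncomputable def tupDet (K : Type*) [Field K] {k : ℕ} (x : Fin k → ℕ) : MvPolynomial (ℕ × ℕ) K :=
  Matrix.detRowAlternating (fun c r : Fin k => (X ((r : ℕ) + 1, x c) : MvPolynomial (ℕ × ℕ) K))

theorem pluMap_X {K : Type*} [Field K] {n k : ℕ} (J : PlVar n k) :
    pluMap K n k (X J) = tupDet K J.val := by
  rw [pluMap, aeval_X, ← Matrix.det_transpose]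
  rfl

theorem exists_sort {n k : ℕ} (x : Fin k → ℕ) (hx : Function.Injective x)
    (hn : ∀ c, 1 ≤ x c ∧ x c ≤ n) :
    ∃ (J : PlVar n k) (e : Equiv.Perm (Fin k)), ∀ c, J.val (e c) = x c := by
  refine ⟨⟨x ∘ Tuple.sort x, (Tuple.monotone_sort x).strictMono_of_injective
    (hx.comp (Tuple.sort x).injective), fun s => hn _⟩, (Tuple.sort x).symm, fun c => ?_⟩
  simp

theorem tupDet_perm {K : Type*} [Field K] {n k : ℕ} (J : PlVar n k) (e : Equiv.Perm (Fin k))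
    (x : Fin k → ℕ) (h : ∀ c, J.val (e c) = x c) :
    tupDet K x = pluMap K n k (X J) ∨ tupDet K x = - pluMap K n k (X J) := by
  have hx : x = J.val ∘ e := funext fun c => (h c).symm
  have h1 : tupDet K x = Equiv.Perm.sign e • tupDet K J.val := by
    rw [tupDet, tupDet, ← AlternatingMap.map_perm, hx]
    rfl
  rw [h1, pluMap_X]
  rcases Int.units_eq_one_or (Equiv.Perm.sign e) with h | h
  · left; rw [h]; simp
  · right; rw [h]; simp

theorem tupDet_zero {K : Type*} [Field K] {k : ℕ}
    (x : Fin k → ℕ) (h : ¬ Function.Injective x) : tupDet K x = 0 := by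
  simp only [Function.Injective, not_forall] at h
  obtain ⟨a, b, hab, hne⟩ := h
  refine AlternatingMap.map_eq_zero_of_eq _ _ (i := a) (j := b) ?_ hne
  rw [hab]

/-- Garnir relations for Plücker coordinates. -/
theorem garnirPl {K : Type*} [Field K] {n k : ℕ} (I J : PlVar n k) (A B : Finset (Fin k))
    (hAB : k < A.card + B.card) (V : Submodule K (MvPolynomial (ℕ × ℕ) K))
    (hV : ∀ π : Equiv.Perm ({i // i ∈ A} ⊕ {i // i ∈ B}), (∃ a b, π (Sum.inl a) = Sum.inr b) →
      ∀ (I' J' : PlVar n k) (e e' : Equiv.Perm (Fin k)),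
      (∀ i, I'.val (e i) = if h : i ∈ A then
          Sum.elim (fun a => I.val a.1) (fun b => J.val b.1) (π (Sum.inl ⟨i, h⟩)) else I.val i) →
      (∀ i, J'.val (e' i) = if h : i ∈ B then
          Sum.elim (fun a => I.val a.1) (fun b => J.val b.1) (π (Sum.inr ⟨i, h⟩)) else J.val i) →
      pluMap K n k (X I') * pluMap K n k (X J') ∈ V) :
    pluMap K n k (X I) * pluMap K n k (X J) ∈ V := by
  rw [pluMap_X, pluMap_X]
  refine garnir Matrix.detRowAlternating _ _ A B hAB V.toAddSubgroup ?_
  intro π hπ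
  set x : Fin k → ℕ := fun i => if h : i ∈ A then
    Sum.elim (fun a => I.val a.1) (fun b => J.val b.1) (π (Sum.inl ⟨i, h⟩)) else I.val i with hx
  set y : Fin k → ℕ := fun i => if h : i ∈ B then
    Sum.elim (fun a => I.val a.1) (fun b => J.val b.1) (π (Sum.inr ⟨i, h⟩)) else J.val i with hy
  have hmain : tupDet K x * tupDet K y ∈ V := by
    by_cases hxi : Function.Injective x
    · by_cases hyi : Function.Injective y
      · have bd : ∀ q : {i // i ∈ A} ⊕ {i // i ∈ B},
            1 ≤ Sum.elim (fun a => I.val a.1) (fun b => J.val b.1) q ∧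
            Sum.elim (fun a => I.val a.1) (fun b => J.val b.1) q ≤ n := by
          rintro (q | q)
          · exact I.2.2 _
          · exact J.2.2 _
        obtain ⟨I', e, hI'⟩ := exists_sort (n := n) x hxi (by
          intro c
          simp only [hx]
          split_ifs
          · exact bd _
          · exact I.2.2 _)
        obtain ⟨J', e', hJ'⟩ := exists_sort (n := n) y hyi (by
          intro c
          simp only [hy]
          split_ifs
          · exact bd _
          · exact J.2.2 _)
        have := hV π hπ I' J' e e' hI' hJ'
        rcases tupDet_perm (K := K) I' e x hI' with h1 | h1 <;>
        rcases tupDet_perm (K := K) J' e' y hJ' with h2 | h2 <;> rw [h1, h2] <;> simpa using this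
      · rw [tupDet_zero y hyi]; simp
    · rw [tupDet_zero x hxi]; simp
  show _ ∈ V
  convert hmain using 2
  · rw [tupDet]
    congr 1
    funext i r
    simp only [hx]
    split_ifs with h
    · rcases π (Sum.inl ⟨i, h⟩) with q | q <;> rfl
    · rfl
  · rw [tupDet]
    congr 1
    funext i r
    simp only [hy]
    split_ifs with h
    · rcases π (Sum.inr ⟨i, h⟩) with q | q <;> rfl
    · rfl

/-- Sum of all entries but the first. -/
def tailSum {n k : ℕ} [NeZero k] (J : PlVar n k) : ℕ := ∑ c ∈ Finset.univ.erase 0, J.val c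

theorem cnt_lt {n k : ℕ} (I' : PlVar n k) (e : Equiv.Perm (Fin k)) (u : ℕ) (t : Fin k)
    (h : (Finset.univ.filter fun c => u ≤ I'.val (e c)).card + t < k) : I'.val t < u := by
  by_contra hcon
  push Not at hcon
  have h1 : (Finset.Ici t).card ≤ (Finset.univ.filter fun c => u ≤ I'.val (e c)).card := by
    refine Finset.card_le_card_of_injOn e.symm ?_ e.symm.injective.injOn
    intro c hc
    have hc' : t ≤ c := by simpa using hc
    simpa using hcon.trans (I'.2.1.monotone hc')
  rw [Fin.card_Ici] at h1
  have := t.2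
  omega

theorem straightA {K : Type*} [Field K] {n k : ℕ} [NeZero k] (I J : PlVar n k) (s : Fin k)
    (hs : s ≠ 0) (hIJ : J.val s < I.val s) (V : Submodule K (MvPolynomial (ℕ × ℕ) K))
    (hV : ∀ I' J' : PlVar n k, tailSum I' < tailSum I →
      pluMap K n k (X I') * pluMap K n k (X J') ∈ V) :
    pluMap K n k (X I) * pluMap K n k (X J) ∈ V := by
  have hs2 := s.2
  refine garnirPl I J (Finset.Ici s) (Finset.Iic s) (by simp; omega) V ?_
  rintro π ⟨a0, b0, hab⟩ I' J' e e' hx -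
  apply hV
  have hinj : Function.Injective (fun c => I'.val (e c)) := I'.2.1.injective.comp e.injective
  have hlow : ∀ c, c < s → I'.val (e c) = I.val c := by
    intro c hc
    rw [hx, dif_neg (by simpa using hc)]
  have hhigh : ∀ c, s ≤ c → (∃ a, s ≤ a ∧ I'.val (e c) = I.val a) ∨ I'.val (e c) < I.val s := by
    intro c hc
    rw [hx, dif_pos (by simpa using hc)]
    rcases π (Sum.inl ⟨c, by simpa using hc⟩) with q | q
    · exact Or.inl ⟨q.1, Finset.mem_Ici.1 q.2, rfl⟩
    · exact Or.inr ((J.2.1.monotone (Finset.mem_Iic.1 q.2)).trans_lt hIJ)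
  have ha0 : I'.val (e a0.1) < I.val s := by
    rw [hx, dif_pos a0.2, hab]
    exact (J.2.1.monotone (Finset.mem_Iic.1 b0.2)).trans_lt hIJ
  have ha0s : s ≤ a0.1 := Finset.mem_Ici.1 a0.2
  have hle : ∀ t, I'.val t ≤ I.val t := by
    intro t
    apply Nat.lt_succ_iff.1
    apply cnt_lt I' e
    have ht := t.2
    suffices h : (Finset.univ.filter fun c => I.val t + 1 ≤ I'.val (e c)).card ≤
        (Finset.Ioi t).card by
      rw [Fin.card_Ioi] at h; simp only [Nat.succ_eq_add_one]; omega
    rcases lt_or_ge t s with hts | hts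
    · apply Finset.card_le_card
      intro c hc
      simp only [Finset.mem_filter, Finset.mem_univ, true_and] at hc
      rw [Finset.mem_Ioi]
      by_contra hct
      push Not at hct
      rw [hlow c (hct.trans_lt hts)] at hc
      have := I.2.1.monotone hct
      omega
    · refine le_trans ?_ (Finset.card_image_le (f := I.val))
      refine Finset.card_le_card_of_injOn (fun c => I'.val (e c)) ?_ hinj.injOn
      intro c hc
      simp only [Finset.coe_filter, Finset.mem_univ, true_and, Set.mem_ofPred_eq] at hc
      have hm := I.2.1.monotone hts
      have hcs : s ≤ c := by
        by_contra hcs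
        push Not at hcs
        rw [hlow c hcs] at hc
        have := I.2.1 hcs
        omega
      rcases hhigh c hcs with ⟨a, -, ha⟩ | h
      · rw [ha] at hc
        simp only [Finset.coe_image, Finset.coe_Ioi, Set.mem_image, Set.mem_Ioi]
        refine ⟨a, ?_, ha.symm⟩
        apply I.2.1.lt_iff_lt.1; omega
      · omega
  have hlt : I'.val s < I.val s := by
    apply cnt_lt I' e
    have : (Finset.univ.filter fun c => I.val s ≤ I'.val (e c)).card ≤
        ((Finset.Ici s).erase a0.1).card := by
      apply Finset.card_le_card
      intro c hc
      simp only [Finset.mem_filter, Finset.mem_univ, true_and] at hc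
      simp only [Finset.mem_erase, Finset.mem_Ici]
      constructor
      · rintro rfl; omega
      · by_contra hcs
        push Not at hcs
        rw [hlow c hcs] at hc
        have := I.2.1 hcs
        omega
    rw [Finset.card_erase_of_mem (by simpa using ha0s), Fin.card_Ici] at this
    omega
  exact Finset.sum_lt_sum (fun t _ => hle t) ⟨s, by simpa using hs, hlt⟩

theorem plVar_ext_range {n k : ℕ} (I J : PlVar n k) (h : Set.range I.val = Set.range J.val) :
    I = J :=
  Subtype.ext ((StrictMono.range_inj I.2.1 J.2.1).1 h)

theorem straightC {K : Type*} [Field K] {n k : ℕ} [NeZero k] (I J I1 J1 : PlVar n k)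
    (h1 : ∀ c, c ≠ 0 → J.val 0 < I.val c)
    (hI1 : I1.val = Function.update I.val 0 (J.val 0))
    (hJ1 : J1.val = Function.update J.val 0 (I.val 0))
    (V : Submodule K (MvPolynomial (ℕ × ℕ) K))
    (hV : ∀ I' J' : PlVar n k, tailSum I' < tailSum I →
      pluMap K n k (X I') * pluMap K n k (X J') ∈ V)
    (hV1 : pluMap K n k (X I1) * pluMap K n k (X J1) ∈ V) :
    pluMap K n k (X I) * pluMap K n k (X J) ∈ V := by
  refine garnirPl I J Finset.univ {0} (by simp) V ?_
  rintro π ⟨a0, b0, hab⟩ I' J' e e' hx hy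
  have hinj : Function.Injective (fun c => I'.val (e c)) := I'.2.1.injective.comp e.injective
  have hb : ∀ b : {i : Fin k // i ∈ ({0} : Finset (Fin k))}, b = ⟨0, by simp⟩ := by
    rintro ⟨b, hb⟩
    simpa using hb
  rcases ht : π (Sum.inr ⟨0, by simp⟩) with t | t
  swap
  · exfalso
    rw [hb b0, ← hb t, ← ht] at hab
    exact absurd (π.injective hab) (by simp)
  have hx' : ∀ c, (∃ a, a ≠ t.1 ∧ I'.val (e c) = I.val a) ∨ I'.val (e c) = J.val 0 := by
    intro c
    rw [hx, dif_pos (Finset.mem_univ _)]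
    rcases hq : π (Sum.inl ⟨c, Finset.mem_univ _⟩) with q | q
    · refine Or.inl ⟨q.1, fun hqt => ?_, rfl⟩
      rw [Subtype.ext hqt, ← ht] at hq
      exact absurd (π.injective hq) (by simp)
    · right
      rw [hb q]
      rfl
  by_cases ht0 : t.1 = 0
  · have e1 : I' = I1 := by
      apply plVar_ext_range
      rw [← e.surjective.range_comp]
      apply Set.Subset.antisymm
      · rintro _ ⟨c, rfl⟩
        rcases hx' c with ⟨a, ha, h⟩ | h
        · refine ⟨a, ?_⟩
          rw [Function.comp_apply, h, hI1, Function.update_of_ne (by rwa [ht0] at ha)]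
        · refine ⟨0, ?_⟩
          rw [Function.comp_apply, h, hI1, Function.update_self]
      · rintro _ ⟨a, rfl⟩
        by_cases ha : a = 0
        · refine ⟨a0.1, ?_⟩
          rw [Function.comp_apply, hx, dif_pos a0.2, hab, hb b0, ha, hI1, Function.update_self]
          rfl
        · rcases hq : π.symm (Sum.inl ⟨a, Finset.mem_univ _⟩) with q | q
          · rw [Equiv.symm_apply_eq] at hq
            refine ⟨q.1, ?_⟩
            rw [Function.comp_apply, hx, dif_pos q.2, ← hq, hI1, Function.update_of_ne ha]
            rfl
          · rw [Equiv.symm_apply_eq, hb q, ht] at hq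
            exact absurd (by rw [← ht0, ← Sum.inl_injective hq]) ha
    have e2 : J' = J1 := by
      apply plVar_ext_range
      rw [← e'.surjective.range_comp]
      congr 1
      funext c
      rw [Function.comp_apply, hy, hJ1]
      by_cases hc : c = 0
      · subst hc
        rw [dif_pos (by simp), ht, Function.update_self]
        simp [ht0]
      · rw [dif_neg (by simpa using hc), Function.update_of_ne hc]
    rw [e1, e2]
    exact hV1
  · apply hV
    have hle : ∀ r, r ≠ 0 → I'.val r ≤ I.val r := by
      intro r hr
      apply Nat.lt_succ_iff.1
      apply cnt_lt I' e
      have hr2 := r.2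
      suffices h : (Finset.univ.filter fun c => I.val r + 1 ≤ I'.val (e c)).card ≤
          (Finset.Ioi r).card by
        rw [Fin.card_Ioi] at h; (try simp only [Nat.succ_eq_add_one]); omega
      refine le_trans ?_ (Finset.card_image_le (f := I.val))
      refine Finset.card_le_card_of_injOn (fun c => I'.val (e c)) ?_ hinj.injOn
      intro c hc
      simp only [Finset.coe_filter, Finset.mem_univ, true_and, Set.mem_ofPred_eq] at hc
      have := h1 r hr
      rcases hx' c with ⟨a, -, ha⟩ | h
      · rw [ha] at hc
        simp only [Finset.coe_image, Finset.coe_Ioi, Set.mem_image, Set.mem_Ioi]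
        refine ⟨a, ?_, ha.symm⟩
        apply I.2.1.lt_iff_lt.1; omega
      · omega
    have hlt : I'.val t.1 < I.val t.1 := by
      apply cnt_lt I' e
      have hr2 := t.1.2
      suffices h : (Finset.univ.filter fun c => I.val t.1 ≤ I'.val (e c)).card ≤
          (Finset.Ioi t.1).card by
        rw [Fin.card_Ioi] at h; (try simp only [Nat.succ_eq_add_one]); omega
      refine le_trans ?_ (Finset.card_image_le (f := I.val))
      refine Finset.card_le_card_of_injOn (fun c => I'.val (e c)) ?_ hinj.injOn
      intro c hc
      simp only [Finset.coe_filter, Finset.mem_univ, true_and, Set.mem_ofPred_eq] at hc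
      have := h1 t.1 ht0
      rcases hx' c with ⟨a, hat, ha⟩ | h
      · rw [ha] at hc
        simp only [Finset.coe_image, Finset.coe_Ioi, Set.mem_image, Set.mem_Ioi]
        refine ⟨a, ?_, ha.symm⟩
        exact lt_of_le_of_ne (I.2.1.le_iff_le.1 hc) (Ne.symm hat)
      · omega
    exact Finset.sum_lt_sum (fun r hr => hle r (by simpa using hr)) ⟨t.1, by simpa using ht0, hlt⟩

/-- A monomial is irreducible when no exchange relation improves it. -/
def Irr {n k : ℕ} [NeZero k] (α : PlVar n k →₀ ℕ) : Prop :=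
  ∀ I ∈ α.support, ∀ J ∈ α.support,
    ¬ (tailSum I ≤ tailSum J ∧ ∃ s, s ≠ 0 ∧ J.val s < I.val s) ∧
    ¬ (tailSum I < tailSum J ∧ I.val 0 < J.val 0 ∧ ∀ c, c ≠ 0 → J.val 0 < I.val c)

theorem tailSum_le {n k : ℕ} [NeZero k] (J : PlVar n k) : tailSum J ≤ k * n := by
  unfold tailSum
  calc _ ≤ ∑ c : Fin k, J.val c := Finset.sum_le_sum_of_subset (Finset.subset_univ _)
    _ ≤ ∑ c : Fin k, n := Finset.sum_le_sum fun c _ => (J.2.2 c).2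
    _ = k * n := by simp

/-- Complementary column weight. -/
def colD {n k : ℕ} [NeZero k] (J : PlVar n k) : ℕ := k * n - tailSum J

/-- Column weight increased by the exchange relations. -/
def colW {n k : ℕ} [NeZero k] (J : PlVar n k) : ℕ :=
  (2 * (n * (k * n)) + 1) * 3 ^ colD J + J.val 0 * colD J

/-- Column weight decreased by the exchange relations. -/
def colC {n k : ℕ} [NeZero k] (J : PlVar n k) : ℕ :=
  ((2 * (n * (k * n)) + 1) * 3 ^ (k * n) + n * (k * n)) - colW J

theorem colW_le {n k : ℕ} [NeZero k] (J : PlVar n k) :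
    colW J ≤ (2 * (n * (k * n)) + 1) * 3 ^ (k * n) + n * (k * n) := by
  have h1 : colD J ≤ k * n := Nat.sub_le _ _
  have h2 : J.val 0 ≤ n := (J.2.2 0).2
  unfold colW
  gcongr
  norm_num

theorem colC_lt {n k : ℕ} [NeZero k] (I J I' J' : PlVar n k)
    (h : colW I + colW J < colW I' + colW J') : colC I' + colC J' < colC I + colC J := by
  have := colW_le I
  have := colW_le J
  have := colW_le I'
  have := colW_le J'
  unfold colC
  omega

theorem colC_A {n k : ℕ} [NeZero k] (I J I' J' : PlVar n k)
    (h : tailSum I ≤ tailSum J) (h' : tailSum I' < tailSum I) :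
    colC I' + colC J' < colC I + colC J := by
  apply colC_lt
  have t1 := tailSum_le I
  have t2 := tailSum_le J
  have t3 := tailSum_le I'
  have d1 : colD J ≤ colD I := by unfold colD; omega
  have d2 : colD I + 1 ≤ colD I' := by unfold colD; omega
  have d3 : colD I ≤ k * n := Nat.sub_le _ _
  have i1 : I.val 0 ≤ n := (I.2.2 0).2
  have j1 : J.val 0 ≤ n := (J.2.2 0).2
  have e1 : colW I ≤ (2 * (n * (k * n)) + 1) * 3 ^ colD I + n * (k * n) := by
    unfold colW; gcongr
  have e2 : colW J ≤ (2 * (n * (k * n)) + 1) * 3 ^ colD I + n * (k * n) := by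
    unfold colW
    gcongr
    · norm_num
    · omega
  have e3 : (2 * (n * (k * n)) + 1) * 3 ^ (colD I + 1) ≤ colW I' := by
    unfold colW
    refine le_trans ?_ (Nat.le_add_right _ _)
    gcongr
    norm_num
  have e4 : (2 * (n * (k * n)) + 1) * 1 ≤ (2 * (n * (k * n)) + 1) * 3 ^ colD I := by
    gcongr
    exact Nat.one_le_pow _ _ (by norm_num)
  rw [pow_succ, ← mul_assoc] at e3
  omega

theorem colC_C {n k : ℕ} [NeZero k] (I J I1 J1 : PlVar n k)
    (h : tailSum I < tailSum J) (h0 : I.val 0 < J.val 0)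
    (hI1 : I1.val = Function.update I.val 0 (J.val 0))
    (hJ1 : J1.val = Function.update J.val 0 (I.val 0)) :
    colC I1 + colC J1 < colC I + colC J := by
  apply colC_lt
  have t1 : tailSum I1 = tailSum I := by
    unfold tailSum
    refine Finset.sum_congr rfl fun c hc => ?_
    rw [hI1, Function.update_of_ne (Finset.ne_of_mem_erase hc)]
  have t2 : tailSum J1 = tailSum J := by
    unfold tailSum
    refine Finset.sum_congr rfl fun c hc => ?_
    rw [hJ1, Function.update_of_ne (Finset.ne_of_mem_erase hc)]
  have u1 := tailSum_le I
  have u2 := tailSum_le J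
  have d1 : colD I1 = colD I := by unfold colD; rw [t1]
  have d2 : colD J1 = colD J := by unfold colD; rw [t2]
  have d3 : colD J < colD I := by unfold colD; omega
  have v1 : I1.val 0 = J.val 0 := by rw [hI1, Function.update_self]
  have v2 : J1.val 0 = I.val 0 := by rw [hJ1, Function.update_self]
  unfold colW
  rw [d1, d2, v1, v2]
  obtain ⟨x, hx⟩ := Nat.exists_eq_add_of_lt d3
  obtain ⟨y, hy⟩ := Nat.exists_eq_add_of_lt h0
  have : I.val 0 * colD I + J.val 0 * colD J < J.val 0 * colD I + I.val 0 * colD J := by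
    rw [hx, hy]
    nlinarith [Nat.zero_le (x * y)]
  omega

theorem exists_update {n k : ℕ} [NeZero k] (I J : PlVar n k)
    (h : ∀ c, c ≠ 0 → J.val 0 < I.val c) :
    ∃ I1 : PlVar n k, I1.val = Function.update I.val 0 (J.val 0) := by
  refine ⟨⟨Function.update I.val 0 (J.val 0), ?_, ?_⟩, rfl⟩
  · intro a b hab
    have hb : b ≠ 0 := by
      rintro rfl
      exact absurd hab (by simp)
    rw [Function.update_of_ne hb]
    by_cases ha : a = 0
    · subst ha
      rw [Function.update_self]
      exact h b hb
    · rw [Function.update_of_ne ha]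
      exact I.2.1 hab
  · intro s
    by_cases hs : s = 0
    · subst hs
      rw [Function.update_self]
      exact J.2.2 0
    · rw [Function.update_of_ne hs]
      exact I.2.2 s

theorem pair_split {n k : ℕ} (α : PlVar n k →₀ ℕ) (I J : PlVar n k) (hI : I ∈ α.support)
    (hJ : J ∈ α.support) (hne : I ≠ J) :
    ∃ β : PlVar n k →₀ ℕ, α = β + (Finsupp.single I 1 + Finsupp.single J 1) := by
  classical
  refine ⟨α - (Finsupp.single I 1 + Finsupp.single J 1), ?_⟩
  rw [tsub_add_cancel_of_le]
  intro x
  rw [Finsupp.mem_support_iff] at hI hJ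
  simp only [Finsupp.add_apply, Finsupp.single_apply]
  by_cases h1 : I = x
  · subst h1
    rw [if_pos rfl, if_neg (Ne.symm hne)]
    omega
  · by_cases h2 : J = x
    · subst h2
      rw [if_neg hne, if_pos rfl]
      omega
    · rw [if_neg h1, if_neg h2]
      omega

theorem plu_pair {K : Type*} [Field K] {n k : ℕ} (β : PlVar n k →₀ ℕ) (I J : PlVar n k) :
    pluMap K n k (monomial (β + (Finsupp.single I 1 + Finsupp.single J 1)) 1) =
      pluMap K n k (monomial β 1) * (pluMap K n k (X I) * pluMap K n k (X J)) := by
  rw [← map_mul, ← map_mul, X, X, monomial_mul, monomial_mul]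
  simp

theorem spanning {K : Type*} [Field K] {n k : ℕ} [NeZero k] (α : PlVar n k →₀ ℕ) :
    pluMap K n k (monomial α 1) ∈
      Submodule.span K {p | ∃ β : PlVar n k →₀ ℕ, Irr β ∧ p = pluMap K n k (monomial β 1)} := by
  induction hN : Finsupp.weight (colC (n := n) (k := k)) α using Nat.strong_induction_on
    generalizing α with
  | _ N ih =>
  by_cases hα : Irr α
  · exact Submodule.subset_span ⟨α, hα, rfl⟩
  unfold Irr at hα
  push Not at hα
  obtain ⟨I, hI, J, hJ, hIJ⟩ := hα
  have hne : I ≠ J := by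
    rintro rfl
    by_cases h1 : tailSum I ≤ tailSum I ∧ ∃ s, s ≠ 0 ∧ I.val s < I.val s
    · obtain ⟨-, s, -, h⟩ := h1
      exact lt_irrefl _ h
    · have := hIJ (by simp)
      exact lt_irrefl _ this.1
  obtain ⟨β, rfl⟩ := pair_split α I J hI hJ hne
  have hw : ∀ I' J' : PlVar n k, colC I' + colC J' < colC I + colC J →
      pluMap K n k (X I') * pluMap K n k (X J') ∈
      Submodule.comap (LinearMap.mulLeft K (pluMap K n k (monomial β 1)))
        (Submodule.span K {p | ∃ β : PlVar n k →₀ ℕ, Irr β ∧ p = pluMap K n k (monomial β 1)}) := by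
    intro I' J' h
    rw [Submodule.mem_comap, LinearMap.mulLeft_apply, ← plu_pair]
    refine ih _ ?_ _ rfl
    rw [← hN]
    simp only [map_add, Finsupp.weight_single, one_smul]
    omega
  rw [plu_pair]
  suffices h : pluMap K n k (X I) * pluMap K n k (X J) ∈
      Submodule.comap (LinearMap.mulLeft K (pluMap K n k (monomial β 1)))
        (Submodule.span K {p | ∃ β : PlVar n k →₀ ℕ, Irr β ∧ p = pluMap K n k (monomial β 1)}) by
    rwa [Submodule.mem_comap, LinearMap.mulLeft_apply] at h
  by_cases h1 : tailSum I ≤ tailSum J ∧ ∃ s, s ≠ 0 ∧ J.val s < I.val s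
  · obtain ⟨ht, s, hs, h⟩ := h1
    exact straightA I J s hs h _ fun I' J' h' => hw I' J' (colC_A _ _ _ _ ht h')
  · obtain ⟨ht, h0, hc⟩ := hIJ (by simpa using h1)
    obtain ⟨I1, hI1⟩ := exists_update I J hc
    obtain ⟨J1, hJ1⟩ := exists_update J I fun c hc =>
      h0.trans (J.2.1 (Fin.pos_iff_ne_zero.2 hc))
    exact straightC I J I1 J1 hc hI1 hJ1 _
      (fun I' J' h' => hw I' J' (colC_A _ _ _ _ ht.le h'))
      (hw I1 J1 (colC_C _ _ _ _ ht h0 hI1 hJ1))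

open Classical in
/-- Number of columns (with multiplicity) satisfying `p`. -/
noncomputable def cnt {n k : ℕ} (α : PlVar n k →₀ ℕ) (p : PlVar n k → Prop) : ℕ :=
  α.sum fun J e => if p J then e else 0

theorem cnt_congr {n k : ℕ} (α : PlVar n k →₀ ℕ) {p q : PlVar n k → Prop}
    (h : ∀ J ∈ α.support, p J ↔ q J) : cnt α p = cnt α q := by
  classical
  unfold cnt Finsupp.sum
  refine Finset.sum_congr rfl fun J hJ => ?_
  simp only [h J hJ]

theorem cnt_mono {n k : ℕ} (α : PlVar n k →₀ ℕ) {p q : PlVar n k → Prop}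
    (h : ∀ J ∈ α.support, p J → q J) : cnt α p ≤ cnt α q := by
  classical
  unfold cnt Finsupp.sum
  refine Finset.sum_le_sum fun J hJ => ?_
  beta_reduce
  by_cases h1 : p J
  · rw [if_pos h1, if_pos (h J hJ h1)]
  · rw [if_neg h1]; exact Nat.zero_le _

theorem cnt_or {n k : ℕ} (α : PlVar n k →₀ ℕ) {p q r : PlVar n k → Prop}
    (h : ∀ J ∈ α.support, r J ↔ (p J ∨ q J)) (h' : ∀ J ∈ α.support, ¬ (p J ∧ q J)) :
    cnt α r = cnt α p + cnt α q := by
  classical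
  unfold cnt Finsupp.sum
  rw [← Finset.sum_add_distrib]
  refine Finset.sum_congr rfl fun J hJ => ?_
  have h1 := h J hJ
  have h2 := h' J hJ
  by_cases hp : p J <;> by_cases hq : q J <;> simp_all

theorem cnt_pos {n k : ℕ} (α : PlVar n k →₀ ℕ) {p : PlVar n k → Prop} :
    0 < cnt α p ↔ ∃ J ∈ α.support, p J := by
  classical
  unfold cnt Finsupp.sum
  rw [Finset.sum_pos_iff]
  constructor
  · rintro ⟨J, hJ, h⟩
    refine ⟨J, hJ, ?_⟩
    by_contra hp
    beta_reduce at h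
    rw [if_neg hp] at h
    exact lt_irrefl _ h
  · rintro ⟨J, hJ, h⟩
    refine ⟨J, hJ, ?_⟩
    beta_reduce
    rw [if_pos h]
    exact Nat.pos_of_ne_zero (Finsupp.mem_support_iff.1 hJ)

theorem cnt_add {n k : ℕ} (α β : PlVar n k →₀ ℕ) (p : PlVar n k → Prop) :
    cnt (α + β) p = cnt α p + cnt β p := by
  classical
  unfold cnt
  refine Finsupp.sum_add_index' (fun J => by simp) fun J a b => ?_
  split_ifs <;> simp

theorem cnt_fiber {n k : ℕ} (α : PlVar n k →₀ ℕ) (p : PlVar n k → Prop) (f : PlVar n k → ℕ)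
    (s : Finset ℕ) : cnt α (fun J => p J ∧ f J ∈ s) = ∑ j ∈ s, cnt α (fun J => p J ∧ f J = j) := by
  classical
  induction s using Finset.induction_on with
  | empty =>
    rw [Finset.sum_empty]
    by_contra h
    obtain ⟨J, -, h⟩ := (cnt_pos α).1 (Nat.pos_of_ne_zero h)
    simp at h
  | insert a s ha ih =>
    rw [Finset.sum_insert ha, ← ih]
    refine cnt_or α (fun J _ => ?_) (fun J _ => ?_)
    · rw [Finset.mem_insert]; tauto
    · rintro ⟨⟨-, h1⟩, -, h2⟩
      rw [h1] at h2
      exact ha h2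

theorem Irr.mono {n k : ℕ} [NeZero k] {α β : PlVar n k →₀ ℕ} (h : Irr (α + β)) : Irr α := by
  intro I hI J hJ
  refine h I ?_ J ?_
  · rw [Finsupp.mem_support_iff] at hI ⊢
    rw [Finsupp.add_apply]; omega
  · rw [Finsupp.mem_support_iff] at hJ ⊢
    rw [Finsupp.add_apply]; omega

theorem exists_min_col {n k : ℕ} [NeZero k] {α : PlVar n k →₀ ℕ} (h : Irr α) (h0 : α ≠ 0) :
    ∃ J ∈ α.support, (∀ M ∈ α.support, ∀ c, c ≠ 0 → J.val c ≤ M.val c) ∧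
      ∀ M ∈ α.support, (∀ c, c ≠ 0 → M.val 0 < J.val c) → M.val 0 ≤ J.val 0 := by
  obtain ⟨J, hJ, hmin⟩ := Finset.exists_min_image α.support
    (fun J => tailSum J * (n + 1) + (n - J.val 0)) (Finsupp.support_nonempty_iff.2 h0)
  have ht : ∀ M ∈ α.support, tailSum J ≤ tailSum M := by
    intro M hM
    have := hmin M hM
    by_contra hc
    push Not at hc
    have h1 : (tailSum M + 1) * (n + 1) ≤ tailSum J * (n + 1) := Nat.mul_le_mul_right _ hc
    have h2 : (tailSum M + 1) * (n + 1) = tailSum M * (n + 1) + n + 1 := by ring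
    omega
  refine ⟨J, hJ, fun M hM c hc => ?_, fun M hM hc => ?_⟩
  · by_contra hlt
    push Not at hlt
    exact (h J hJ M hM).1 ⟨ht M hM, c, hc, hlt⟩
  · by_contra hlt
    push Not at hlt
    rcases (ht M hM).lt_or_eq with h1 | h1
    · exact (h J hJ M hM).2 ⟨h1, hlt, hc⟩
    · have := hmin M hM
      rw [h1] at this
      have := (J.2.2 0).2
      have := (M.2.2 0).2
      omega

theorem removal {n k : ℕ} [NeZero k] (N : ℕ) : ∀ (α β : PlVar n k →₀ ℕ), Finsupp.degree α = N →
    Irr α → Irr β →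
    (∀ c j, cnt α (fun J => J.val c = j) = cnt β (fun J => J.val c = j)) → α = β := by
  induction N with
  | zero =>
    intro α β hN _ _ hc
    have hα : α = 0 := (Finsupp.degree_eq_zero_iff α).1 hN
    subst hα
    by_contra hβ
    obtain ⟨J, hJ⟩ := Finsupp.support_nonempty_iff.2 (Ne.symm hβ)
    have : 0 < cnt β (fun M => M.val 0 = J.val 0) := (cnt_pos β).2 ⟨J, hJ, rfl⟩
    rw [← hc] at this
    obtain ⟨M, hM, -⟩ := (cnt_pos _).1 this
    simp at hM
  | succ N ih =>
    intro α β hN hα hβ hc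
    have hα0 : α ≠ 0 := by rintro rfl; simp at hN
    have tr : ∀ J ∈ α.support, ∀ c, ∃ M ∈ β.support, M.val c = J.val c := by
      intro J hJ c
      rw [← cnt_pos (p := fun M => M.val c = J.val c), ← hc, cnt_pos]
      exact ⟨J, hJ, rfl⟩
    have tr' : ∀ J ∈ β.support, ∀ c, ∃ M ∈ α.support, M.val c = J.val c := by
      intro J hJ c
      rw [← cnt_pos (p := fun M => M.val c = J.val c), hc, cnt_pos]
      exact ⟨J, hJ, rfl⟩
    have hβ0 : β ≠ 0 := by
      obtain ⟨J, hJ⟩ := Finsupp.support_nonempty_iff.2 hα0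
      obtain ⟨M, hM, -⟩ := tr J hJ 0
      exact Finsupp.support_nonempty_iff.1 ⟨M, hM⟩
    obtain ⟨J, hJ, h1, h2⟩ := exists_min_col hα hα0
    obtain ⟨J', hJ', h1', h2'⟩ := exists_min_col hβ hβ0
    have e1 : ∀ c, c ≠ 0 → J.val c = J'.val c := by
      intro c hc0
      obtain ⟨M, hM, hMc⟩ := tr J hJ c
      obtain ⟨M', hM', hMc'⟩ := tr' J' hJ' c
      have := h1 M' hM' c hc0
      have := h1' M hM c hc0
      omega
    have e0 : J.val 0 = J'.val 0 := by
      obtain ⟨M, hM, hM0⟩ := tr J hJ 0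
      obtain ⟨M', hM', hM0'⟩ := tr' J' hJ' 0
      have a1 := h2 M' hM' fun c hc0 => by
        rw [hM0', e1 c hc0]; exact J'.2.1 (Fin.pos_iff_ne_zero.2 hc0)
      have a2 := h2' M hM fun c hc0 => by
        rw [hM0, ← e1 c hc0]; exact J.2.1 (Fin.pos_iff_ne_zero.2 hc0)
      omega
    have eJ : J = J' := by
      apply Subtype.ext
      funext c
      by_cases h : c = 0
      · rw [h, e0]
      · exact e1 c h
    subst eJ
    have sp : ∀ γ : PlVar n k →₀ ℕ, J ∈ γ.support → ∃ δ, γ = δ + Finsupp.single J 1 := by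
      intro γ hγ
      refine ⟨γ - Finsupp.single J 1, ?_⟩
      rw [tsub_add_cancel_of_le]
      rw [Finsupp.single_le_iff]
      rw [Finsupp.mem_support_iff] at hγ
      omega
    obtain ⟨α', rfl⟩ := sp α hJ
    obtain ⟨β', rfl⟩ := sp β hJ'
    rw [ih α' β' _ hα.mono hβ.mono _]
    · rw [map_add, Finsupp.degree_single] at hN
      omega
    · intro c j
      have := hc c j
      rw [cnt_add, cnt_add] at this
      omega

/-- The permutation describing the matching field on the column `J`. -/
def tau {k : ℕ} (ℓ : ℕ) (J : Fin k → ℕ) : Equiv.Perm (Fin k) :=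
  if h : 2 ≤ k ∧ nSmall ℓ J = 1 then Equiv.swap ⟨0, by omega⟩ ⟨1, by omega⟩ else 1

theorem tau_tau {k : ℕ} (ℓ : ℕ) (J : Fin k → ℕ) (c : Fin k) : tau ℓ J (tau ℓ J c) = c := by
  unfold tau
  split_ifs <;> simp

theorem mfRow_eq {k : ℕ} (ℓ : ℕ) (J : Fin k → ℕ) (c : Fin k) :
    mfRow ℓ J c = (tau ℓ J c : ℕ) + 1 := by
  unfold mfRow tau
  split_ifs with h h0 h1
  · have : c = ⟨0, by omega⟩ := Fin.ext h0
    rw [this, Equiv.swap_apply_left]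
  · have : c = ⟨1, by omega⟩ := Fin.ext h1
    rw [this, Equiv.swap_apply_right]
  · rw [Equiv.swap_apply_of_ne_of_ne]
    · intro h; exact h0 (congrArg Fin.val h)
    · intro h; exact h1 (congrArg Fin.val h)
  · rfl

theorem nSmall_eq_one {n m : ℕ} (ℓ : ℕ) (J : PlVar n (m + 2)) :
    nSmall ℓ J.val = 1 ↔ J.val 0 ≤ ℓ ∧ ℓ < J.val 1 := by
  unfold nSmall
  constructor
  · intro h
    have h0 : J.val 0 ≤ ℓ := by
      by_contra hc
      push Not at hc
      rw [Finset.card_eq_zero.2] at h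
      · omega
      · rw [Finset.filter_eq_empty_iff]
        intro s _
        have := J.2.1.monotone (Fin.zero_le s)
        omega
    refine ⟨h0, ?_⟩
    by_contra hc
    push Not at hc
    rw [Finset.card_eq_one] at h
    obtain ⟨a, ha⟩ := h
    have m0 : (0 : Fin (m + 2)) ∈ Finset.univ.filter fun s => J.val s ≤ ℓ := by simpa using h0
    have m1 : (1 : Fin (m + 2)) ∈ Finset.univ.filter fun s => J.val s ≤ ℓ := by simpa using hc
    rw [ha, Finset.mem_singleton] at m0 m1
    rw [← m1] at m0
    exact absurd m0 (by simp)
  · rintro ⟨h0, h1⟩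
    rw [Finset.card_eq_one]
    refine ⟨0, ?_⟩
    ext s
    simp only [Finset.mem_filter, Finset.mem_univ, true_and, Finset.mem_singleton]
    constructor
    · intro hs
      by_contra hne
      have : (1 : Fin (m + 2)) ≤ s := Fin.one_le_of_ne_zero hne
      have := J.2.1.monotone this
      omega
    · rintro rfl
      exact h0

theorem tau_eq {n m : ℕ} (ℓ : ℕ) (J : PlVar n (m + 2)) :
    tau ℓ J.val = if J.val 0 ≤ ℓ ∧ ℓ < J.val 1 then Equiv.swap 0 1 else 1 := by
  unfold tau
  by_cases h : J.val 0 ≤ ℓ ∧ ℓ < J.val 1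
  · rw [if_pos h, dif_pos ⟨by omega, (nSmall_eq_one ℓ J).2 h⟩]
    rfl
  · rw [if_neg h, dif_neg fun h' => h ((nSmall_eq_one ℓ J).1 h'.2)]

/-- Exponent of the monomial attached to `P_J`. -/
noncomputable def phiExp {n k : ℕ} (ℓ : ℕ) (J : PlVar n k) : (ℕ × ℕ) →₀ ℕ :=
  ∑ c : Fin k, Finsupp.single (mfRow ℓ J.val c, J.val c) 1

theorem phiExp_apply {n k : ℕ} (ℓ : ℕ) (J : PlVar n k) (r : Fin k) (j : ℕ) :
    phiExp ℓ J ((r : ℕ) + 1, j) = if J.val (tau ℓ J.val r) = j then 1 else 0 := by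
  unfold phiExp
  rw [Finsupp.finsetSum_apply, Finset.sum_eq_single (tau ℓ J.val r)]
  · rw [mfRow_eq, tau_tau, Finsupp.single_apply]
    simp
  · intro c _ hc
    rw [mfRow_eq, Finsupp.single_apply, if_neg]
    intro h
    apply hc
    have : (tau ℓ J.val c) = r := by
      apply Fin.ext
      have := congrArg Prod.fst h
      simpa using this
    rw [← this, tau_tau]
  · simp

/-- Exponent of the image of a monomial. -/
noncomputable def expo {n k : ℕ} (ℓ : ℕ) (α : PlVar n k →₀ ℕ) : (ℕ × ℕ) →₀ ℕ :=
  Finsupp.weight (phiExp ℓ) α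

theorem expo_apply {n k : ℕ} (ℓ : ℕ) (α : PlVar n k →₀ ℕ) (r : Fin k) (j : ℕ) :
    expo ℓ α ((r : ℕ) + 1, j) = cnt α (fun J => J.val (tau ℓ J.val r) = j) := by
  classical
  unfold expo cnt
  rw [Finsupp.weight_apply]
  unfold Finsupp.sum
  rw [Finsupp.finsetSum_apply]
  refine Finset.sum_congr rfl fun J _ => ?_
  rw [Finsupp.smul_apply, phiExp_apply]
  beta_reduce
  split_ifs <;> simp

theorem phi_X {K : Type*} [Field K] {n k : ℕ} (ℓ : ℕ) (J : PlVar n k) :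
    phiMF K n k ℓ (X J) = monomial (phiExp ℓ J) 1 := by
  rw [phiMF, aeval_X, phiExp, monomial_sum_one]
  rfl

theorem phi_monomial {K : Type*} [Field K] {n k : ℕ} (ℓ : ℕ) (α : PlVar n k →₀ ℕ) :
    phiMF K n k ℓ (monomial α 1) = monomial (expo ℓ α) 1 := by
  induction α using Finsupp.induction_linear with
  | zero => simp [expo]
  | add f g hf hg =>
    have : (monomial (f + g) (1 : K)) = monomial f 1 * monomial g 1 := by
      rw [monomial_mul, one_mul]
    rw [this, map_mul, hf, hg, monomial_mul, one_mul, expo, expo, expo, map_add]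
  | single J e =>
    have : (monomial (Finsupp.single J e) (1 : K)) = X J ^ e := by
      rw [X_pow_eq_monomial]
    rw [this, map_pow, phi_X, monomial_pow, one_pow, expo, Finsupp.weight_single]

/-- All row counts for `k ≥ 2`. -/
theorem rows_le {n m ℓ : ℕ} {α β : PlVar n (m + 2) →₀ ℕ} (h : expo ℓ α = expo ℓ β) (j : ℕ)
    (hj : j ≤ ℓ) :
    cnt α (fun J => J.val 1 ≤ ℓ ∧ J.val 0 = j) = cnt β (fun J => J.val 1 ≤ ℓ ∧ J.val 0 = j) ∧
    cnt α (fun J => J.val 1 = j) + cnt α (fun J => J.val 0 = j ∧ ℓ < J.val 1) =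
      cnt β (fun J => J.val 1 = j) + cnt β (fun J => J.val 0 = j ∧ ℓ < J.val 1) := by
  have h0 := congrArg (fun f => f (((0 : Fin (m + 2)) : ℕ) + 1, j)) h
  have h1 := congrArg (fun f => f (((1 : Fin (m + 2)) : ℕ) + 1, j)) h
  beta_reduce at h0 h1
  rw [expo_apply, expo_apply] at h0 h1
  have A : ∀ γ : PlVar n (m + 2) →₀ ℕ, cnt γ (fun J => J.val (tau ℓ J.val 0) = j) =
      cnt γ (fun J => J.val 1 ≤ ℓ ∧ J.val 0 = j) := by
    intro γ
    refine cnt_congr _ fun J _ => ?_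
    have := J.2.1 (show (0 : Fin (m + 2)) < 1 by simp)
    rw [tau_eq]
    split_ifs with hs
    · rw [Equiv.swap_apply_left]; omega
    · rw [Equiv.Perm.one_apply]; omega
  have B : ∀ γ : PlVar n (m + 2) →₀ ℕ, cnt γ (fun J => J.val (tau ℓ J.val 1) = j) =
      cnt γ (fun J => J.val 1 = j) + cnt γ (fun J => J.val 0 = j ∧ ℓ < J.val 1) := by
    intro γ
    refine cnt_or _ (fun J _ => ?_) (fun J _ => ?_)
    · have := J.2.1 (show (0 : Fin (m + 2)) < 1 by simp)
      rw [tau_eq]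
      split_ifs with hs
      · rw [Equiv.swap_apply_right]; omega
      · rw [Equiv.Perm.one_apply]; omega
    · omega
  rw [A, A] at h0
  rw [B, B] at h1
  exact ⟨h0, h1⟩

theorem rows_gt {n m ℓ : ℕ} {α β : PlVar n (m + 2) →₀ ℕ} (h : expo ℓ α = expo ℓ β) (j : ℕ)
    (hj : ℓ < j) :
    cnt α (fun J => ℓ < J.val 0 ∧ J.val 1 = j) = cnt β (fun J => ℓ < J.val 0 ∧ J.val 1 = j) ∧
    cnt α (fun J => J.val 0 = j) + cnt α (fun J => J.val 1 = j ∧ J.val 0 ≤ ℓ) =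
      cnt β (fun J => J.val 0 = j) + cnt β (fun J => J.val 1 = j ∧ J.val 0 ≤ ℓ) := by
  have h0 := congrArg (fun f => f (((0 : Fin (m + 2)) : ℕ) + 1, j)) h
  have h1 := congrArg (fun f => f (((1 : Fin (m + 2)) : ℕ) + 1, j)) h
  beta_reduce at h0 h1
  rw [expo_apply, expo_apply] at h0 h1
  have A : ∀ γ : PlVar n (m + 2) →₀ ℕ, cnt γ (fun J => J.val (tau ℓ J.val 1) = j) =
      cnt γ (fun J => ℓ < J.val 0 ∧ J.val 1 = j) := by
    intro γ
    refine cnt_congr _ fun J _ => ?_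
    have := J.2.1 (show (0 : Fin (m + 2)) < 1 by simp)
    rw [tau_eq]
    split_ifs with hs
    · rw [Equiv.swap_apply_right]; omega
    · rw [Equiv.Perm.one_apply]; omega
  have B : ∀ γ : PlVar n (m + 2) →₀ ℕ, cnt γ (fun J => J.val (tau ℓ J.val 0) = j) =
      cnt γ (fun J => J.val 0 = j) + cnt γ (fun J => J.val 1 = j ∧ J.val 0 ≤ ℓ) := by
    intro γ
    refine cnt_or _ (fun J _ => ?_) (fun J _ => ?_)
    · have := J.2.1 (show (0 : Fin (m + 2)) < 1 by simp)
      rw [tau_eq]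
      split_ifs with hs
      · rw [Equiv.swap_apply_left]; omega
      · rw [Equiv.Perm.one_apply]; omega
    · omega
  rw [A, A] at h1
  rw [B, B] at h0
  exact ⟨h1, h0⟩

theorem Y_not_lt {n m ℓ : ℕ} {α β : PlVar n (m + 2) →₀ ℕ} (hβ : Irr β)
    (h : expo ℓ α = expo ℓ β) (v : ℕ) (hv : v ≤ ℓ)
    (ih : ∀ j < v, cnt α (fun J => J.val 1 = j) = cnt β (fun J => J.val 1 = j)) :
    ¬ cnt β (fun J => J.val 1 = v) < cnt α (fun J => J.val 1 = v) := by
  intro hlt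
  have hG : 0 < cnt β (fun J => J.val 0 = v ∧ ℓ < J.val 1) := by
    have := (rows_le h v hv).2
    omega
  obtain ⟨M, hM, hM0, hM1⟩ := (cnt_pos β).1 hG
  have a1 : cnt α (fun J => True ∧ J.val 1 ∈ Finset.range (v + 1)) ≤
      cnt α (fun J => J.val 1 ≤ ℓ ∧ J.val 0 ∈ Finset.range v) := by
    refine cnt_mono _ fun J _ => ?_
    have := J.2.1 (show (0 : Fin (m + 2)) < 1 by simp)
    simp only [Finset.mem_range]
    omega
  have a2 : cnt β (fun J => J.val 1 ≤ ℓ ∧ J.val 0 ∈ Finset.range v) ≤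
      cnt β (fun J => True ∧ J.val 1 ∈ Finset.range (v + 1)) := by
    refine cnt_mono _ fun J hJ => ?_
    simp only [Finset.mem_range, true_and]
    rintro ⟨b1, b2⟩
    by_contra hc
    refine (hβ J hJ M hM).2 ⟨?_, by omega, ?_⟩
    · by_contra ht
      exact (hβ M hM J hJ).1 ⟨by omega, 1, by simp, by omega⟩
    · intro c hc0
      have := J.2.1.monotone (Fin.one_le_of_ne_zero hc0)
      omega
  have a3 : cnt α (fun J => J.val 1 ≤ ℓ ∧ J.val 0 ∈ Finset.range v) =
      cnt β (fun J => J.val 1 ≤ ℓ ∧ J.val 0 ∈ Finset.range v) := by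
    rw [cnt_fiber α (fun J => J.val 1 ≤ ℓ) (fun J => J.val 0),
      cnt_fiber β (fun J => J.val 1 ≤ ℓ) (fun J => J.val 0)]
    refine Finset.sum_congr rfl fun j hj => (rows_le h j ?_).1
    rw [Finset.mem_range] at hj
    omega
  have a4 : cnt β (fun J => True ∧ J.val 1 ∈ Finset.range (v + 1)) <
      cnt α (fun J => True ∧ J.val 1 ∈ Finset.range (v + 1)) := by
    rw [cnt_fiber α (fun J => True) (fun J => J.val 1),
      cnt_fiber β (fun J => True) (fun J => J.val 1), Finset.sum_range_succ, Finset.sum_range_succ]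
    simp only [true_and]
    rw [Finset.sum_congr rfl fun j hj => ih j (Finset.mem_range.1 hj)]
    omega
  omega

theorem Y_eq {n m ℓ : ℕ} {α β : PlVar n (m + 2) →₀ ℕ} (hα : Irr α) (hβ : Irr β)
    (h : expo ℓ α = expo ℓ β) (v : ℕ) (hv : v ≤ ℓ) :
    cnt α (fun J => J.val 1 = v) = cnt β (fun J => J.val 1 = v) := by
  induction v using Nat.strong_induction_on with
  | _ v ih =>
  have ih' : ∀ j < v, cnt α (fun J => J.val 1 = j) = cnt β (fun J => J.val 1 = j) :=
    fun j hj => ih j hj (by omega)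
  have h1 := Y_not_lt hβ h v hv ih'
  have h2 := Y_not_lt hα h.symm v hv fun j hj => (ih' j hj).symm
  omega

theorem P_not_lt {n m ℓ : ℕ} {α β : PlVar n (m + 2) →₀ ℕ} (hβ : Irr β)
    (h : expo ℓ α = expo ℓ β) (v : ℕ) (hv : ℓ < v) (hvn : v ≤ n)
    (ih : ∀ j, v < j → cnt α (fun J => J.val 0 = j) = cnt β (fun J => J.val 0 = j)) :
    ¬ cnt β (fun J => J.val 0 = v) < cnt α (fun J => J.val 0 = v) := by
  intro hlt
  have hG : 0 < cnt β (fun J => J.val 1 = v ∧ J.val 0 ≤ ℓ) := by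
    have := (rows_gt h v hv).2
    omega
  obtain ⟨M, hM, hM0, hM1⟩ := (cnt_pos β).1 hG
  have a1 : cnt α (fun J => True ∧ J.val 0 ∈ Finset.Icc v n) ≤
      cnt α (fun J => ℓ < J.val 0 ∧ J.val 1 ∈ Finset.Ioc v n) := by
    refine cnt_mono _ fun J _ => ?_
    have := J.2.1 (show (0 : Fin (m + 2)) < 1 by simp)
    have := (J.2.2 1).2
    simp only [Finset.mem_Icc, Finset.mem_Ioc]
    omega
  have a2 : cnt β (fun J => ℓ < J.val 0 ∧ J.val 1 ∈ Finset.Ioc v n) ≤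
      cnt β (fun J => True ∧ J.val 0 ∈ Finset.Icc v n) := by
    refine cnt_mono _ fun J hJ => ?_
    simp only [Finset.mem_Icc, Finset.mem_Ioc, true_and]
    rintro ⟨b1, b2, b3⟩
    refine ⟨?_, (J.2.2 0).2⟩
    by_contra hc
    refine (hβ M hM J hJ).2 ⟨?_, by omega, ?_⟩
    · by_contra ht
      exact (hβ J hJ M hM).1 ⟨by omega, 1, by simp, by omega⟩
    · intro c hc0
      have := M.2.1.monotone (Fin.one_le_of_ne_zero hc0)
      omega
  have a3 : cnt α (fun J => ℓ < J.val 0 ∧ J.val 1 ∈ Finset.Ioc v n) =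
      cnt β (fun J => ℓ < J.val 0 ∧ J.val 1 ∈ Finset.Ioc v n) := by
    rw [cnt_fiber α (fun J => ℓ < J.val 0) (fun J => J.val 1),
      cnt_fiber β (fun J => ℓ < J.val 0) (fun J => J.val 1)]
    refine Finset.sum_congr rfl fun j hj => (rows_gt h j ?_).1
    rw [Finset.mem_Ioc] at hj
    omega
  have a4 : cnt β (fun J => True ∧ J.val 0 ∈ Finset.Icc v n) <
      cnt α (fun J => True ∧ J.val 0 ∈ Finset.Icc v n) := by
    rw [cnt_fiber α (fun J => True) (fun J => J.val 0),
      cnt_fiber β (fun J => True) (fun J => J.val 0), ← Finset.Ioc_insert_left hvn,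
      Finset.sum_insert (by simp), Finset.sum_insert (by simp)]
    simp only [true_and]
    rw [Finset.sum_congr rfl fun j hj => ih j (Finset.mem_Ioc.1 hj).1]
    omega
  omega

theorem P_eq {n m ℓ : ℕ} {α β : PlVar n (m + 2) →₀ ℕ} (hα : Irr α) (hβ : Irr β)
    (h : expo ℓ α = expo ℓ β) (v : ℕ) (hv : ℓ < v) :
    cnt α (fun J => J.val 0 = v) = cnt β (fun J => J.val 0 = v) := by
  induction hd : n + 1 - v using Nat.strong_induction_on generalizing v with
  | _ d ih =>
  by_cases hvn : v ≤ n
  · have ih' : ∀ j, v < j → cnt α (fun J => J.val 0 = j) = cnt β (fun J => J.val 0 = j) :=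
      fun j hj => ih _ (by omega) j (by omega) rfl
    have h1 := P_not_lt hβ h v hv hvn ih'
    have h2 := P_not_lt hα h.symm v hv hvn fun j hj => (ih' j hj).symm
    omega
  · have z : ∀ γ : PlVar n (m + 2) →₀ ℕ, cnt γ (fun J => J.val 0 = v) = 0 := by
      intro γ
      by_contra hc
      obtain ⟨J, -, hJ⟩ := (cnt_pos γ).1 (Nat.pos_of_ne_zero hc)
      have := (J.2.2 0).2
      omega
    rw [z, z]

theorem expo_inj {n k ℓ : ℕ} [NeZero k] {α β : PlVar n k →₀ ℕ} (hα : Irr α) (hβ : Irr β)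
    (h : expo ℓ α = expo ℓ β) : α = β := by
  refine removal _ α β rfl hα hβ ?_
  intro c j
  have hr := congrArg (fun f => f ((c : ℕ) + 1, j)) h
  beta_reduce at hr
  rw [expo_apply, expo_apply] at hr
  rcases k with _ | _ | m
  · exact c.elim0
  · have t : ∀ J : PlVar n (0 + 1), tau ℓ J.val c = c := fun J => Fin.ext (by omega)
    simpa only [t] using hr
  · by_cases hc0 : c = 0
    · subst hc0
      by_cases hj : j ≤ ℓ
      · have s : ∀ γ : PlVar n (m + 2) →₀ ℕ, cnt γ (fun J => J.val 0 = j) =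
            cnt γ (fun J => J.val 1 ≤ ℓ ∧ J.val 0 = j) +
            cnt γ (fun J => J.val 0 = j ∧ ℓ < J.val 1) :=
          fun γ => cnt_or γ (fun J _ => by omega) (fun J _ => by omega)
        have h1 := rows_le h j hj
        have h2 := Y_eq hα hβ h j hj
        refine (s α).trans (Eq.trans ?_ (s β).symm)
        omega
      · exact P_eq hα hβ h j (by omega)
    · by_cases hc1 : c = 1
      · subst hc1
        by_cases hj : j ≤ ℓ
        · exact Y_eq hα hβ h j hj
        · have s : ∀ γ : PlVar n (m + 2) →₀ ℕ, cnt γ (fun J => J.val 1 = j) =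
              cnt γ (fun J => ℓ < J.val 0 ∧ J.val 1 = j) +
              cnt γ (fun J => J.val 1 = j ∧ J.val 0 ≤ ℓ) :=
            fun γ => cnt_or γ (fun J _ => by omega) (fun J _ => by omega)
          have h1 := rows_gt h j (by omega)
          have h2 := P_eq hα hβ h j (by omega)
          refine (s α).trans (Eq.trans ?_ (s β).symm)
          omega
      · have t : ∀ J : PlVar n (m + 2), tau ℓ J.val c = c := by
          intro J
          rw [tau_eq]
          split_ifs
          · exact Equiv.swap_apply_of_ne_of_ne hc0 hc1
          · rfl
        simpa only [t] using hr

/-- Weight of the term of the minor on `J` attached to `σ`. -/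
def permWt {n k : ℕ} (ℓ : ℕ) (J : PlVar n k) (σ : Equiv.Perm (Fin k)) : ℤ :=
  ∑ c : Fin k, Mmat n ℓ ((σ c : ℕ) + 1) (J.val c)

theorem permWt_swap {n k : ℕ} (ℓ : ℕ) (J : PlVar n k) (σ : Equiv.Perm (Fin k)) (a b : Fin k)
    (hab : a ≠ b) : permWt ℓ J σ - permWt ℓ J (σ * Equiv.swap a b) =
      (Mmat n ℓ ((σ a : ℕ) + 1) (J.val a) - Mmat n ℓ ((σ b : ℕ) + 1) (J.val a)) +
      (Mmat n ℓ ((σ b : ℕ) + 1) (J.val b) - Mmat n ℓ ((σ a : ℕ) + 1) (J.val b)) := by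
  unfold permWt
  rw [← Finset.sum_sub_distrib, Finset.sum_eq_add a b hab]
  · simp
  · rintro c - ⟨h1, h2⟩
    rw [Equiv.Perm.mul_apply, Equiv.swap_apply_of_ne_of_ne h1 h2, sub_self]
  · simp
  · simp

theorem Mmat_gain {n ℓ a b x y : ℕ} (ha : 2 ≤ a) (hba : b < a) (hxy : x < y) (hx : 1 ≤ x)
    (hy : y ≤ n) :
    0 < (Mmat n ℓ (a + 1) x - Mmat n ℓ (b + 1) x) + (Mmat n ℓ (b + 1) y - Mmat n ℓ (a + 1) y) := by
  unfold Mmat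
  rw [if_neg (by omega : ¬ a + 1 = 2), if_neg (by omega : ¬ a + 1 = 2)]
  push_cast
  have h1 : (2 : ℤ) ≤ a := by exact_mod_cast ha
  have h2 : (b : ℤ) + 1 ≤ a := by exact_mod_cast hba
  have h3 : (x : ℤ) + 1 ≤ y := by exact_mod_cast hxy
  have h4 : (1 : ℤ) ≤ x := by exact_mod_cast hx
  have h5 : (y : ℤ) ≤ n := by exact_mod_cast hy
  have e : ((a : ℤ) - 1) * (y - x) ≥ 1 * 1 := by
    apply mul_le_mul <;> linarith
  have e' : ((a : ℤ) - b) * (y - x) ≥ 1 * 1 := by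
    apply mul_le_mul <;> linarith
  split_ifs <;> nlinarith

theorem exists_better {n k : ℕ} (ℓ : ℕ) (J : PlVar n k) (σ : Equiv.Perm (Fin k))
    (hσ : σ ≠ tau ℓ J.val) : ∃ σ', permWt ℓ J σ' < permWt ℓ J σ := by
  by_cases hfix : ∃ c : Fin k, 2 ≤ (c : ℕ) ∧ σ.symm c ≠ c
  · obtain ⟨a, ha, hmax⟩ := Finset.exists_max_image
      (Finset.univ.filter fun c : Fin k => 2 ≤ (c : ℕ) ∧ σ.symm c ≠ c) id (by
        obtain ⟨c, hc⟩ := hfix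
        exact ⟨c, by simpa using hc⟩)
    simp only [Finset.mem_filter, Finset.mem_univ, true_and, id] at ha hmax
    have hbig : ∀ c, a < c → σ.symm c = c := by
      intro c hc
      by_contra hne
      have h1 : (a : ℕ) < c := hc
      exact absurd (hmax c ⟨by omega, hne⟩) (not_le.2 hc)
    have hc1 : σ.symm a < a := by
      rcases lt_trichotomy (σ.symm a) a with h | h | h
      · exact h
      · exact absurd h ha.2
      · have := hbig _ h
        exact absurd (σ.symm.injective this) ha.2
    have hc2 : σ a < a := by
      rcases lt_trichotomy (σ a) a with h | h | h
      · exact h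
      · exact absurd (by rw [Equiv.symm_apply_eq, h]) ha.2
      · have := hbig _ h
        rw [Equiv.symm_apply_apply] at this
        exact absurd h (by rw [← this]; exact lt_irrefl _)
    refine ⟨σ * Equiv.swap (σ.symm a) a, ?_⟩
    have := permWt_swap ℓ J σ (σ.symm a) a ha.2
    rw [Equiv.apply_symm_apply] at this
    have g := Mmat_gain (n := n) (ℓ := ℓ) (a := a) (b := σ a) ha.1 hc2 (J.2.1 hc1)
      (J.2.2 _).1 (J.2.2 _).2
    linarith
  · push Not at hfix
    rcases k with _ | _ | m
    · exact absurd (Equiv.ext fun c => c.elim0) hσ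
    · exact absurd (Equiv.ext fun c => Fin.ext (by omega)) hσ
    · have hfix' : ∀ c : Fin (m + 2), c ≠ 0 → c ≠ 1 → σ c = c := by
        intro c h0 h1
        have : 2 ≤ (c : ℕ) := by
          have a0 : (c : ℕ) ≠ 0 := fun h => h0 (Fin.ext h)
          have a1 : (c : ℕ) ≠ 1 := fun h => h1 (Fin.ext h)
          omega
        have := hfix c this
        rw [Equiv.symm_apply_eq] at this
        exact this.symm
      have hne : (0 : Fin (m + 2)) ≠ 1 := by simp
      have h01 : ∀ c : Fin (m + 2), c = 0 ∨ c = 1 → σ c = 0 ∨ σ c = 1 := by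
        intro c hc
        by_contra hcon
        push Not at hcon
        have := σ.injective (hfix' _ hcon.1 hcon.2)
        rw [this] at hcon
        tauto
      have hcase : σ = 1 ∨ σ = Equiv.swap 0 1 := by
        rcases h01 0 (Or.inl rfl) with h | h
        · left
          have h' : σ 1 = 1 := by
            rcases h01 1 (Or.inr rfl) with h2 | h2
            · exact absurd (σ.injective (h.trans h2.symm)) hne
            · exact h2
          ext c
          by_cases c0 : c = 0
          · rw [c0, h]; rfl
          · by_cases c1 : c = 1
            · rw [c1, h']; rfl
            · rw [hfix' c c0 c1]; rfl
        · right
          have h' : σ 1 = 0 := by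
            rcases h01 1 (Or.inr rfl) with h2 | h2
            · exact h2
            · exact absurd (σ.injective (h.trans h2.symm)) hne
          ext c
          by_cases c0 : c = 0
          · rw [c0, h, Equiv.swap_apply_left]
          · by_cases c1 : c = 1
            · rw [c1, h', Equiv.swap_apply_right]
            · rw [hfix' c c0 c1, Equiv.swap_apply_of_ne_of_ne c0 c1]
      refine ⟨σ * Equiv.swap 0 1, ?_⟩
      have hW := permWt_swap (k := m + 2) ℓ J σ 0 1 hne
      have hJ := J.2.1 (show (0 : Fin (m + 2)) < 1 by simp)
      have hJ0 : 1 ≤ J.val 0 := (J.2.2 0).1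
      have hJ1 : J.val 1 ≤ n := (J.2.2 1).2
      have ht := tau_eq (m := m) ℓ J
      have v0 : ((0 : Fin (m + 2)) : ℕ) = 0 := rfl
      have v1 : ((1 : Fin (m + 2)) : ℕ) = 1 := rfl
      rcases hcase with rfl | rfl
      · rw [Equiv.Perm.one_apply, Equiv.Perm.one_apply, v0, v1] at hW
        have hs : J.val 0 ≤ ℓ ∧ ℓ < J.val 1 := by
          by_contra hs
          rw [if_neg hs] at ht
          exact hσ ht.symm
        rw [← sub_pos]
        generalize permWt ℓ J _ - permWt ℓ J _ = D at hW ⊢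
        simp only [Mmat] at hW
        norm_num at hW
        rw [if_pos hs.1, if_neg (by omega)] at hW
        omega
      · rw [Equiv.swap_apply_left, Equiv.swap_apply_right, v0, v1] at hW
        have hs : ¬ (J.val 0 ≤ ℓ ∧ ℓ < J.val 1) := by
          intro hs
          rw [if_pos hs] at ht
          exact hσ ht.symm
        rw [← sub_pos]
        generalize permWt ℓ J _ - permWt ℓ J _ = D at hW ⊢
        simp only [Mmat] at hW
        norm_num at hW
        split_ifs at hW <;> omega

theorem wVec_eq {n k : ℕ} (ℓ : ℕ) (J : PlVar n k) : wVec n ℓ J.val = permWt ℓ J (tau ℓ J.val) := by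
  unfold wVec permWt
  simp only [mfRow_eq]

theorem permWt_lt {n k : ℕ} (ℓ : ℕ) (J : PlVar n k) (σ : Equiv.Perm (Fin k))
    (hσ : σ ≠ tau ℓ J.val) : wVec n ℓ J.val < permWt ℓ J σ := by
  obtain ⟨σ0, -, hmin⟩ := Finset.exists_min_image (Finset.univ : Finset (Equiv.Perm (Fin k)))
    (permWt ℓ J) ⟨1, Finset.mem_univ _⟩
  have h0 : σ0 = tau ℓ J.val := by
    by_contra h
    obtain ⟨σ', h'⟩ := exists_better ℓ J σ0 h
    exact absurd (hmin σ' (Finset.mem_univ _)) (not_le.2 h')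
  obtain ⟨σ', h'⟩ := exists_better ℓ J σ hσ
  rw [wVec_eq, ← h0]
  exact (hmin σ' (Finset.mem_univ _)).trans_lt h'

/-- Weight of the matrix variables. -/
def xWt (n ℓ : ℕ) : ℕ × ℕ → ℤ := fun p => Mmat n ℓ p.1 p.2

/-- Signs used to compare the minors with the matching field. -/
def sg (K : Type*) [Field K] (k ℓ : ℕ) : ℕ × ℕ → K :=
  fun p => if 2 ≤ k ∧ p.1 ≤ 2 ∧ ℓ < p.2 then -1 else 1

theorem sg_ne {K : Type*} [Field K] (k ℓ : ℕ) (p : ℕ × ℕ) : sg K k ℓ p ≠ 0 := by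
  unfold sg
  split_ifs <;> simp

/-- The sign changing automorphism. -/
noncomputable def psi (K : Type*) [Field K] (k ℓ : ℕ) :
    MvPolynomial (ℕ × ℕ) K →ₐ[K] MvPolynomial (ℕ × ℕ) K :=
  aeval fun p => C (sg K k ℓ p) * X p

theorem psi_monomial {K : Type*} [Field K] (k ℓ : ℕ) (μ : (ℕ × ℕ) →₀ ℕ) :
    psi K k ℓ (monomial μ 1) = monomial μ (μ.prod fun p e => sg K k ℓ p ^ e) := by
  rw [psi, aeval_monomial, map_one, one_mul]
  simp only [mul_pow]
  rw [Finsupp.prod_mul]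
  rw [monomial_eq (s := μ), Finsupp.prod, Finsupp.prod, Finsupp.prod, map_prod]
  simp only [map_pow]

theorem sgprod_ne {K : Type*} [Field K] (k ℓ : ℕ) (μ : (ℕ × ℕ) →₀ ℕ) :
    (μ.prod fun p e => sg K k ℓ p ^ e) ≠ 0 :=
  Finset.prod_ne_zero_iff.2 fun p _ => pow_ne_zero _ (sg_ne k ℓ p)

theorem sgprod_tau {K : Type*} [Field K] {n k : ℕ} (ℓ : ℕ) (J : PlVar n k) :
    ∏ c : Fin k, sg K k ℓ (mfRow ℓ J.val c, J.val c) =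
      ((Equiv.Perm.sign (tau ℓ J.val) : ℤ) : K) := by
  rcases k with _ | _ | m
  · have : tau ℓ J.val = 1 := Equiv.ext fun c => c.elim0
    rw [this]; simp
  · have : tau ℓ J.val = 1 := Equiv.ext fun c => Fin.ext (by omega)
    rw [this]; simp [sg]
  · have ht := tau_eq (m := m) ℓ J
    have hJ := J.2.1 (show (0 : Fin (m + 2)) < 1 by simp)
    rw [Fin.prod_univ_succ, Fin.prod_univ_succ, Finset.prod_eq_one]
    · have v : (Fin.succ (0 : Fin (m + 1))) = 1 := rfl
      rw [v, mfRow_eq, mfRow_eq]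
      have v0 : ((0 : Fin (m + 2)) : ℕ) = 0 := rfl
      have v1 : ((1 : Fin (m + 2)) : ℕ) = 1 := rfl
      by_cases hs : J.val 0 ≤ ℓ ∧ ℓ < J.val 1
      · rw [if_pos hs] at ht
        rw [ht, Equiv.swap_apply_left, Equiv.swap_apply_right, Equiv.Perm.sign_swap (by simp)]
        unfold sg
        rw [v0, v1]
        dsimp only
        rw [if_neg (by omega), if_pos (by omega)]
        simp
      · rw [if_neg hs] at ht
        rw [ht, Equiv.Perm.one_apply, Equiv.Perm.one_apply]
        unfold sg
        rw [v0, v1]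
        dsimp only
        by_cases h0 : ℓ < J.val 0
        · rw [if_pos (by omega), if_pos (by omega)]
          simp
        · rw [if_neg (by omega), if_neg (by omega)]
          simp
    · intro c _
      have hc : tau ℓ J.val c.succ.succ = c.succ.succ := by
        rw [ht]
        split_ifs
        · apply Equiv.swap_apply_of_ne_of_ne
          · intro h
            have := congrArg Fin.val h
            simp at this
          · intro h
            have := congrArg Fin.val h
            simp at this
        · rfl
      rw [mfRow_eq, hc]
      unfold sg
      rw [if_neg]
      simp

/-- Exponent of the term of the minor on `J` attached to `σ`. -/
noncomputable def permExp {n k : ℕ} (J : PlVar n k) (σ : Equiv.Perm (Fin k)) : (ℕ × ℕ) →₀ ℕ :=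
  ∑ c : Fin k, Finsupp.single ((σ c : ℕ) + 1, J.val c) 1

theorem weight_permExp {n k : ℕ} (ℓ : ℕ) (J : PlVar n k) (σ : Equiv.Perm (Fin k)) :
    Finsupp.weight (xWt n ℓ) (permExp J σ) = permWt ℓ J σ := by
  unfold permExp permWt
  rw [map_sum]
  refine Finset.sum_congr rfl fun c _ => ?_
  rw [Finsupp.weight_single, one_smul]
  rfl

theorem phiExp_eq {n k : ℕ} (ℓ : ℕ) (J : PlVar n k) : phiExp ℓ J = permExp J (tau ℓ J.val) := by
  unfold phiExp permExp
  simp only [mfRow_eq]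

theorem plu_X_sum {K : Type*} [Field K] {n k : ℕ} (J : PlVar n k) :
    pluMap K n k (X J) = ∑ σ : Equiv.Perm (Fin k),
      monomial (permExp J σ) ((Equiv.Perm.sign σ : ℤ) : K) := by
  rw [pluMap, aeval_X, Matrix.det_apply]
  refine Finset.sum_congr rfl fun σ _ => ?_
  have h : ∏ i, (Matrix.of fun r c : Fin k => (X ((r : ℕ) + 1, J.val c) :
      MvPolynomial (ℕ × ℕ) K)) (σ i) i = monomial (permExp J σ) 1 := by
    rw [permExp, monomial_sum_one]
    rfl
  rw [h]
  rcases Int.units_eq_one_or (Equiv.Perm.sign σ) with h | h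
  · rw [h]; simp
  · rw [h]; simp

theorem psiphi_X {K : Type*} [Field K] {n k : ℕ} (ℓ : ℕ) (J : PlVar n k) :
    psi K k ℓ (phiMF K n k ℓ (X J)) =
      monomial (permExp J (tau ℓ J.val)) ((Equiv.Perm.sign (tau ℓ J.val) : ℤ) : K) := by
  rw [phi_X, ← sgprod_tau (K := K) ℓ J, ← phiExp_eq, phiExp, monomial_sum_one, map_prod]
  have : ∀ c : Fin k, psi K k ℓ (monomial (Finsupp.single (mfRow ℓ J.val c, J.val c) 1) 1) =
      C (sg K k ℓ (mfRow ℓ J.val c, J.val c)) *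
        monomial (Finsupp.single (mfRow ℓ J.val c, J.val c) 1) 1 := by
    intro c
    rw [psi_monomial, C_mul_monomial]
    simp
  simp only [this]
  rw [Finset.prod_mul_distrib, ← map_prod, ← monomial_sum_one, C_mul_monomial, mul_one]

/-- `q` is homogeneous of weight `d` and `p - q` only has larger weights. -/
def Ld {K : Type*} [Field K] (u : ℕ × ℕ → ℤ) (p q : MvPolynomial (ℕ × ℕ) K) (d : ℤ) : Prop :=
  (∀ μ ∈ q.support, Finsupp.weight u μ = d) ∧ (∀ μ ∈ (p - q).support, d < Finsupp.weight u μ)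

theorem Ld.mul {K : Type*} [Field K] {u : ℕ × ℕ → ℤ} {p q p' q' : MvPolynomial (ℕ × ℕ) K}
    {d d' : ℤ} (h : Ld u p q d) (h' : Ld u p' q' d') : Ld u (p * p') (q * q') (d + d') := by
  classical
  constructor
  · intro μ hμ
    obtain ⟨a, ha, b, hb, rfl⟩ := Finset.mem_add.1 (support_mul _ _ hμ)
    rw [map_add, h.1 a ha, h'.1 b hb]
  · intro μ hμ
    have e : p * p' - q * q' = (p - q) * (p' - q') + q * (p' - q') + (p - q) * q' := by ring
    rw [e] at hμ
    rcases Finset.mem_union.1 (support_add hμ) with hμ | hμ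
    · rcases Finset.mem_union.1 (support_add hμ) with hμ | hμ
      · obtain ⟨a, ha, b, hb, rfl⟩ := Finset.mem_add.1 (support_mul _ _ hμ)
        rw [map_add]
        exact add_lt_add (h.2 a ha) (h'.2 b hb)
      · obtain ⟨a, ha, b, hb, rfl⟩ := Finset.mem_add.1 (support_mul _ _ hμ)
        rw [map_add, h.1 a ha]
        have := h'.2 b hb
        linarith
    · obtain ⟨a, ha, b, hb, rfl⟩ := Finset.mem_add.1 (support_mul _ _ hμ)
      rw [map_add, h'.1 b hb]
      have := h.2 a ha
      linarith

theorem Ld.one {K : Type*} [Field K] (u : ℕ × ℕ → ℤ) : Ld u (1 : MvPolynomial (ℕ × ℕ) K) 1 0 := by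
  constructor
  · intro μ hμ
    have : μ = 0 := by
      rw [mem_support_iff, coeff_one] at hμ
      by_contra h
      exact hμ (if_neg (Ne.symm h))
    rw [this, map_zero]
  · intro μ hμ
    simp at hμ

theorem Ld.pow {K : Type*} [Field K] {u : ℕ × ℕ → ℤ} {p q : MvPolynomial (ℕ × ℕ) K}
    {d : ℤ} (h : Ld u p q d) (e : ℕ) : Ld u (p ^ e) (q ^ e) (e • d) := by
  induction e with
  | zero => simpa using Ld.one u
  | succ e ih =>
    rw [pow_succ, pow_succ, succ_nsmul]
    exact ih.mul h

theorem ld_X {K : Type*} [Field K] {n k : ℕ} (ℓ : ℕ) (J : PlVar n k) :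
    Ld (xWt n ℓ) (pluMap K n k (X J)) (psi K k ℓ (phiMF K n k ℓ (X J))) (wVec n ℓ J.val) := by
  classical
  constructor
  · intro μ hμ
    rw [psiphi_X] at hμ
    have : μ = permExp J (tau ℓ J.val) := by
      simpa using support_monomial_subset hμ
    rw [this, weight_permExp, wVec_eq]
  · intro μ hμ
    rw [psiphi_X, plu_X_sum, ← Finset.sum_erase_add _ _ (Finset.mem_univ (tau ℓ J.val)),
      add_sub_cancel_right] at hμ
    obtain ⟨σ, hσ, h⟩ := Finset.mem_biUnion.1 (support_sum hμ)
    have : μ = permExp J σ := by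
      simpa using support_monomial_subset h
    rw [this, weight_permExp]
    exact permWt_lt ℓ J σ (Finset.ne_of_mem_erase hσ)

theorem ld_monomial {K : Type*} [Field K] {n k : ℕ} (ℓ : ℕ) (α : PlVar n k →₀ ℕ) :
    Ld (xWt n ℓ) (pluMap K n k (monomial α 1)) (psi K k ℓ (phiMF K n k ℓ (monomial α 1)))
      (Finsupp.weight (fun J : PlVar n k => wVec n ℓ J.val) α) := by
  induction α using Finsupp.induction_linear with
  | zero => simpa using Ld.one (K := K) (xWt n ℓ)
  | add f g hf hg =>
    have : (monomial (f + g) (1 : K)) = monomial f 1 * monomial g 1 := by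
      rw [monomial_mul, one_mul]
    rw [this, map_mul, map_mul, map_mul, map_add]
    exact hf.mul hg
  | single J e =>
    have : (monomial (Finsupp.single J e) (1 : K)) = X J ^ e := by
      rw [X_pow_eq_monomial]
    rw [this, map_pow, map_pow, map_pow, Finsupp.weight_single]
    exact (ld_X ℓ J).pow e

theorem weight_expo {n k : ℕ} (ℓ : ℕ) (α : PlVar n k →₀ ℕ) :
    Finsupp.weight (xWt n ℓ) (expo ℓ α) =
      Finsupp.weight (fun J : PlVar n k => wVec n ℓ J.val) α := by
  induction α using Finsupp.induction_linear with
  | zero => simp [expo]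
  | add f g hf hg =>
    rw [expo] at hf hg ⊢
    rw [map_add, map_add, map_add, hf, hg]
  | single J e =>
    rw [expo, Finsupp.weight_single, Finsupp.weight_single, map_nsmul, phiExp_eq, weight_permExp,
      wVec_eq]

/-- Coefficients in weights up to the weight of `α`. -/
theorem coeff_plu_monomial {K : Type*} [Field K] {n k : ℕ} (ℓ : ℕ) (α : PlVar n k →₀ ℕ)
    (μ : (ℕ × ℕ) →₀ ℕ) (hμ : Finsupp.weight (xWt n ℓ) μ ≤
      Finsupp.weight (fun J : PlVar n k => wVec n ℓ J.val) α) :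
    coeff μ (pluMap K n k (monomial α 1)) =
      coeff μ (psi K k ℓ (phiMF K n k ℓ (monomial α 1))) := by
  by_contra h
  have : μ ∈ (pluMap K n k (monomial α 1) -
      psi K k ℓ (phiMF K n k ℓ (monomial α 1))).support := by
    rw [mem_support_iff, coeff_sub]
    exact sub_ne_zero.2 h
  exact absurd ((ld_monomial ℓ α).2 μ this) (not_lt.2 hμ)

theorem poly_sum {K σ : Type*} [Field K] (f : MvPolynomial σ K) :
    f = ∑ α ∈ f.support, coeff α f • monomial α (1 : K) := by
  conv_lhs => rw [f.as_sum]
  refine Finset.sum_congr rfl fun α _ => ?_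
  rw [smul_monomial, smul_eq_mul, mul_one]

/-- Coefficients of small weight of a polynomial under the Plücker map. -/
theorem coeff_plu {K : Type*} [Field K] {n k : ℕ} (ℓ : ℕ) (f : MvPolynomial (PlVar n k) K)
    (μ : (ℕ × ℕ) →₀ ℕ) (hμ : ∀ α ∈ f.support, Finsupp.weight (xWt n ℓ) μ ≤
      Finsupp.weight (fun J : PlVar n k => wVec n ℓ J.val) α) :
    coeff μ (pluMap K n k f) = coeff μ (psi K k ℓ (phiMF K n k ℓ f)) := by
  conv_lhs => rw [poly_sum f]
  conv_rhs => rw [poly_sum f]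
  rw [map_sum, map_sum, map_sum, coeff_sum, coeff_sum]
  refine Finset.sum_congr rfl fun α hα => ?_
  rw [map_smul, map_smul, map_smul, coeff_smul, coeff_smul, coeff_plu_monomial ℓ α μ (hμ α hα)]

theorem exists_irr {K : Type*} [Field K] {n k : ℕ} [NeZero k] (f : MvPolynomial (PlVar n k) K) :
    ∃ h : MvPolynomial (PlVar n k) K, (∀ α ∈ h.support, Irr α) ∧
      pluMap K n k h = pluMap K n k f := by
  classical
  have key : ∀ p ∈ Submodule.span K
      {p | ∃ β : PlVar n k →₀ ℕ, Irr β ∧ p = pluMap K n k (monomial β 1)},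
      ∃ h : MvPolynomial (PlVar n k) K, (∀ α ∈ h.support, Irr α) ∧ pluMap K n k h = p := by
    intro p hp
    induction hp using Submodule.span_induction with
    | mem x hx =>
      obtain ⟨β, hβ, rfl⟩ := hx
      refine ⟨monomial β 1, fun α hα => ?_, rfl⟩
      have : α = β := by simpa using support_monomial_subset hα
      rwa [this]
    | zero => exact ⟨0, by simp, by simp⟩
    | add x y _ _ hx hy =>
      obtain ⟨a, ha, rfl⟩ := hx
      obtain ⟨b, hb, rfl⟩ := hy
      refine ⟨a + b, fun α hα => ?_, map_add _ _ _⟩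
      rcases Finset.mem_union.1 (support_add hα) with h | h
      · exact ha α h
      · exact hb α h
    | smul c x _ hx =>
      obtain ⟨a, ha, rfl⟩ := hx
      exact ⟨c • a, fun α hα => ha α (support_smul hα), map_smul _ _ _⟩
  apply key
  rw [poly_sum f, map_sum]
  refine Submodule.sum_mem _ fun α _ => ?_
  rw [map_smul]
  exact Submodule.smul_mem _ _ (spanning α)

theorem coeff_psiphi_irr {K : Type*} [Field K] {n k : ℕ} [NeZero k] (ℓ : ℕ)
    (h : MvPolynomial (PlVar n k) K) (hirr : ∀ α ∈ h.support, Irr α) (β : PlVar n k →₀ ℕ)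
    (hβ : β ∈ h.support) : coeff (expo ℓ β) (psi K k ℓ (phiMF K n k ℓ h)) ≠ 0 := by
  classical
  rw [poly_sum h, map_sum, map_sum, coeff_sum, Finset.sum_eq_single β]
  · rw [map_smul, map_smul, coeff_smul, phi_monomial, psi_monomial, coeff_monomial, if_pos rfl]
    exact mul_ne_zero (mem_support_iff.1 hβ) (sgprod_ne k ℓ _)
  · intro α hα hne
    rw [map_smul, map_smul, coeff_smul, phi_monomial, psi_monomial, coeff_monomial, if_neg,
      smul_zero]
    exact fun he => hne (expo_inj (hirr α hα) (hirr β hβ) he)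
  · exact fun hn => absurd hβ hn

theorem lifting {K : Type*} [Field K] {n k : ℕ} [NeZero k] (ℓ : ℕ)
    (f : MvPolynomial (PlVar n k) K) (d : ℤ)
    (hd : ∀ α ∈ f.support, Finsupp.weight (fun J : PlVar n k => wVec n ℓ J.val) α = d)
    (hf : phiMF K n k ℓ f = 0) :
    ∃ g : MvPolynomial (PlVar n k) K, pluMap K n k g = 0 ∧
      ∀ α ∈ (f - g).support, d < Finsupp.weight (fun J : PlVar n k => wVec n ℓ J.val) α := by
  obtain ⟨h, hirr, hplu⟩ := exists_irr f
  refine ⟨f - h, by rw [map_sub, hplu, sub_self], ?_⟩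
  rw [sub_sub_cancel]
  intro m hm
  obtain ⟨m0, hm0, hmin⟩ := Finset.exists_min_image h.support
    (Finsupp.weight (fun J : PlVar n k => wVec n ℓ J.val)) ⟨m, hm⟩
  refine lt_of_lt_of_le ?_ (hmin m hm)
  by_contra hle
  push Not at hle
  apply coeff_psiphi_irr ℓ h hirr m0 hm0
  rw [← coeff_plu ℓ h, hplu, coeff_plu ℓ f, hf, map_zero, coeff_zero]
  · intro α hα
    rw [hd α hα, weight_expo]
    exact hle
  · intro α hα
    rw [weight_expo]
    exact hmin α hα

theorem whc_monomial {K σ : Type*} [Field K] (u : σ → ℤ) (d : ℤ) (α : σ →₀ ℕ) (a : K) :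
    weightedHomogeneousComponent u d (monomial α a) =
      if Finsupp.weight u α = d then monomial α a else 0 := by
  classical
  ext μ
  rw [coeff_weightedHomogeneousComponent]
  by_cases h : α = μ
  · subst h
    split_ifs <;> simp
  · split_ifs <;> simp [coeff_monomial, h]

theorem phi_whc {K : Type*} [Field K] {n k : ℕ} (ℓ : ℕ) (d : ℤ)
    (F : MvPolynomial (PlVar n k) K) :
    phiMF K n k ℓ (weightedHomogeneousComponent (fun J : PlVar n k => wVec n ℓ J.val) d F) =
      weightedHomogeneousComponent (xWt n ℓ) d (phiMF K n k ℓ F) := by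
  have hm : ∀ α : PlVar n k →₀ ℕ, phiMF K n k ℓ
      (weightedHomogeneousComponent (fun J : PlVar n k => wVec n ℓ J.val) d (monomial α 1)) =
      weightedHomogeneousComponent (xWt n ℓ) d (phiMF K n k ℓ (monomial α 1)) := by
    intro α
    rw [phi_monomial, whc_monomial, whc_monomial, weight_expo]
    split_ifs
    · exact phi_monomial ℓ α
    · exact map_zero _
  rw [poly_sum F, map_sum, map_sum, map_sum, map_sum]
  refine Finset.sum_congr rfl fun α _ => ?_
  rw [map_smul, map_smul, map_smul, map_smul, hm]

theorem coeff_kill {K σ : Type*} [Field K] (T : Set σ) (p : MvPolynomial σ K) (m : T →₀ ℕ) :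
    coeff m (killCompl (R := K) (f := fun x : T => (x : σ)) Subtype.val_injective p) =
      coeff (m.mapDomain (fun x : T => (x : σ))) p := by
  classical
  have hinj : Function.Injective (fun x : T => (x : σ)) := Subtype.val_injective
  have hm : ∀ s : σ →₀ ℕ, coeff m
      (killCompl (R := K) (f := fun x : T => (x : σ)) hinj (monomial s 1)) =
      coeff (m.mapDomain (fun x : T => (x : σ))) (monomial s (1 : K)) := by
    intro s
    by_cases hs : (s.support : Set σ) ⊆ Set.range (fun x : T => (x : σ))
    · have e : Finsupp.mapDomain (fun x : T => (x : σ)) (s.comapDomain _ hinj.injOn) = s :=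
        Finsupp.mapDomain_comapDomain _ hinj s hs
      rw [← e, killCompl_monomial_mapDomain, coeff_monomial, coeff_monomial]
      simp only [(Finsupp.mapDomain_injective hinj).eq_iff]
    · rw [killCompl_monomial_eq_zero_of_not_subset hinj _ hs, coeff_zero, coeff_monomial, if_neg]
      rintro rfl
      apply hs
      intro x hx
      have := Finsupp.mapDomain_support hx
      obtain ⟨y, -, rfl⟩ := Finset.mem_image.1 this
      exact ⟨y, rfl⟩
  rw [poly_sum p, map_sum, coeff_sum, coeff_sum]
  refine Finset.sum_congr rfl fun α _ => ?_
  rw [map_smul, coeff_smul, coeff_smul, hm]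

theorem expWt_eq {σ : Type*} (u : σ → ℤ) (m : σ →₀ ℕ) : expWt u m = Finsupp.weight u m := by
  rw [expWt, Finsupp.weight_apply]
  refine Finset.sum_congr rfl fun i _ => ?_
  beta_reduce
  rw [nsmul_eq_mul, mul_comm]

theorem weight_mapDomain_val {σ : Type*} (T : Set σ) (u : σ → ℤ) (m : T →₀ ℕ) :
    Finsupp.weight u (m.mapDomain (fun x : T => (x : σ))) =
      Finsupp.weight (fun x : T => u x) m := by
  rw [Finsupp.weight_apply, Finsupp.weight_apply, Finsupp.sum_mapDomain_index]
  · simp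
  · intro b x y; rw [add_smul]

theorem rename_kill_sub {K σ : Type*} [Field K] (T : Set σ) (p : MvPolynomial σ K) :
    rename (fun x : T => (x : σ))
      (killCompl (R := K) (f := fun x : T => (x : σ)) Subtype.val_injective p) - p ∈
      Ideal.span (X '' {J | J ∉ T} : Set (MvPolynomial σ K)) := by
  classical
  rw [← Ideal.Quotient.eq]
  have h : ((Ideal.Quotient.mkₐ K (Ideal.span (X '' {J | J ∉ T} : Set (MvPolynomial σ K)))).comp
      (rename (fun x : T => (x : σ)))).comp
      (killCompl (R := K) (f := fun x : T => (x : σ)) Subtype.val_injective) =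
      Ideal.Quotient.mkₐ K (Ideal.span (X '' {J | J ∉ T} : Set (MvPolynomial σ K))) := by
    apply MvPolynomial.algHom_ext
    intro J
    by_cases hJ : J ∈ T
    · have e : (X J : MvPolynomial σ K) = rename (fun x : T => (x : σ)) (X ⟨J, hJ⟩) := by
        rw [rename_X]
      rw [AlgHom.comp_apply, AlgHom.comp_apply, e, killCompl_rename_app]
    · have e : killCompl (R := K) (f := fun x : T => (x : σ)) Subtype.val_injective (X J) = 0 := by
        rw [killCompl, aeval_X, dif_neg]
        rintro ⟨y, hy⟩
        exact hJ (hy ▸ y.2)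
      rw [AlgHom.comp_apply, AlgHom.comp_apply, e, map_zero, map_zero]
      symm
      rw [Ideal.Quotient.mkₐ_eq_mk, Ideal.Quotient.eq_zero_iff_mem]
      exact Ideal.subset_span ⟨J, hJ, rfl⟩
  exact congrArg (fun g => g p) h

theorem kill_span {K σ : Type*} [Field K] (T : Set σ) (p : MvPolynomial σ K)
    (hp : p ∈ Ideal.span (X '' {J | J ∉ T} : Set (MvPolynomial σ K))) :
    killCompl (R := K) (f := fun x : T => (x : σ)) Subtype.val_injective p = 0 := by
  classical
  have : Ideal.span (X '' {J | J ∉ T} : Set (MvPolynomial σ K)) ≤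
      RingHom.ker (killCompl (R := K) (f := fun x : T => (x : σ)) Subtype.val_injective) := by
    rw [Ideal.span_le]
    rintro _ ⟨J, hJ, rfl⟩
    rw [SetLike.mem_coe, RingHom.mem_ker, killCompl, aeval_X, dif_neg]
    rintro ⟨y, hy⟩
    exact hJ (hy ▸ y.2)
  exact RingHom.mem_ker.1 (this hp)

theorem initialForm_eq {K σ : Type*} [Field K] (u : σ → ℤ) (f g : MvPolynomial σ K) (d : ℤ)
    (hf : ∀ α ∈ f.support, Finsupp.weight u α = d) (hf0 : f ≠ 0)
    (hg : ∀ α ∈ (f - g).support, d < Finsupp.weight u α) : initialForm u g = f := by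
  classical
  have hco : ∀ α, Finsupp.weight u α ≤ d → coeff α g = coeff α f := by
    intro α hα
    by_contra h
    exact absurd (hg α (by rw [mem_support_iff, coeff_sub]; exact sub_ne_zero.2 (Ne.symm h)))
      (not_lt.2 hα)
  have hge : ∀ α ∈ g.support, d ≤ Finsupp.weight u α := by
    intro α hα
    by_contra h
    push Not at h
    rw [mem_support_iff, hco α h.le, ← mem_support_iff] at hα
    exact absurd (hf α hα) h.ne
  obtain ⟨α0, hα0⟩ := support_nonempty.2 hf0
  have hα0g : α0 ∈ g.support := by
    rw [mem_support_iff, hco α0 (hf α0 hα0).le, ← mem_support_iff]; exact hα0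
  have hfil : g.support.filter (fun m => ∀ m' ∈ g.support, expWt u m ≤ expWt u m') =
      f.support := by
    ext m
    simp only [expWt_eq, Finset.mem_filter]
    constructor
    · rintro ⟨h1, h2⟩
      have := h2 α0 hα0g
      rw [hf α0 hα0] at this
      rw [mem_support_iff, ← hco m this, ← mem_support_iff]
      exact h1
    · intro h
      refine ⟨?_, fun m' hm' => ?_⟩
      · rw [mem_support_iff, hco m (hf m h).le, ← mem_support_iff]; exact h
      · rw [hf m h]; exact hge m' hm'
  rw [initialForm, hfil]
  conv_rhs => rw [f.as_sum]
  exact Finset.sum_congr rfl fun m hm => by rw [hco m (hf m hm).le]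

theorem main_aux (K : Type*) [Field K] (n k ℓ : ℕ) [NeZero k] (T : Set (PlVar n k)) :
    restrictIdeal (RingHom.ker (phiMF K n k ℓ)) T ≤
      initialIdeal (fun x : T => wVec n ℓ (x : PlVar n k).val)
        (restrictIdeal (RingHom.ker (pluMap K n k)) T) := by
  classical
  intro f hf
  rw [restrictIdeal, Ideal.mem_comap, Submodule.mem_sup] at hf
  obtain ⟨F, hF, h, hh, hsum⟩ := hf
  have hF0 : phiMF K n k ℓ F = 0 := hF
  have hπF : killCompl (R := K) (f := fun x : T => (x : PlVar n k)) Subtype.val_injective F = f := by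
    have := congrArg
      (killCompl (R := K) (f := fun x : T => (x : PlVar n k)) Subtype.val_injective) hsum
    rw [map_add, kill_span T h hh, add_zero] at this
    rw [this]
    exact killCompl_rename_app Subtype.val_injective f
  have hcomp : ∀ d : ℤ, weightedHomogeneousComponent
      (fun x : T => wVec n ℓ (x : PlVar n k).val) d f ∈
      initialIdeal (fun x : T => wVec n ℓ (x : PlVar n k).val)
        (restrictIdeal (RingHom.ker (pluMap K n k)) T) := by
    intro d
    by_cases h0 : weightedHomogeneousComponent
      (fun x : T => wVec n ℓ (x : PlVar n k).val) d f = 0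
    · rw [h0]; exact Ideal.zero_mem _
    obtain ⟨g, hg, hgw⟩ := lifting ℓ
      (weightedHomogeneousComponent (fun J : PlVar n k => wVec n ℓ J.val) d F) d (by
        intro α hα
        rw [mem_support_iff, coeff_weightedHomogeneousComponent] at hα
        by_contra hne
        exact hα (if_neg hne)) (by rw [phi_whc, hF0, map_zero])
    apply Ideal.subset_span
    refine ⟨killCompl (R := K) (f := fun x : T => (x : PlVar n k)) Subtype.val_injective g, ?_, ?_⟩
    · rw [restrictIdeal, Ideal.mem_comap]
      refine Submodule.mem_sup.2 ⟨g, hg, _, rename_kill_sub T g, ?_⟩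
      rw [add_sub_cancel]
    · symm
      apply initialForm_eq _ _ _ d
      · intro α hα
        rw [mem_support_iff, coeff_weightedHomogeneousComponent] at hα
        by_contra hne
        exact hα (if_neg hne)
      · exact h0
      · intro α hα
        rw [← weight_mapDomain_val T (fun J : PlVar n k => wVec n ℓ J.val)]
        apply hgw
        rw [mem_support_iff] at hα ⊢
        rw [coeff_sub, coeff_weightedHomogeneousComponent, coeff_kill] at hα
        rw [coeff_sub, coeff_weightedHomogeneousComponent, weight_mapDomain_val, ← coeff_kill T F,
          hπF]
        exact hα
  have hdec : f = ∑ d ∈ f.support.image (Finsupp.weight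
      (fun x : T => wVec n ℓ (x : PlVar n k).val)),
      weightedHomogeneousComponent (fun x : T => wVec n ℓ (x : PlVar n k).val) d f := by
    ext m
    rw [coeff_sum]
    simp only [coeff_weightedHomogeneousComponent]
    rw [Finset.sum_ite_eq]
    split_ifs with hm
    · rfl
    · by_contra hne
      exact hm (Finset.mem_image_of_mem _ (mem_support_iff.2 hne))
  rw [hdec]
  exact Ideal.sum_mem _ fun d _ => hcomp d

/-- The restricted ideal `G_{k,n,ℓ}|_w^v = ker(φ_ℓ)|_{T_w^v}` is
contained in the initial ideal `in_{w_ℓ}(I(X_w^v))` of the Richardson ideal with respect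
to the matching field weight vector `w_ℓ`. -/
theorem statement_17 (K : Type*) [Field K] (n k ℓ : ℕ) (hk : 0 < k) (hkn : k < n)
    (hℓn : ℓ ≤ n) (v w : PlVar n k) (hvw : TupLe v.val w.val) :
    restrictIdeal (RingHom.ker (phiMF K n k ℓ)) (TWV v w) ≤
      initialIdeal (fun x : TWV v w => wVec n ℓ (x : PlVar n k).val)
        (richIdeal K n k v w) := by
  haveI : NeZero k := ⟨hk.ne.symm⟩
  exact main_aux K n k ℓ (TWV v w)
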